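/- arXiv:1508.02092 — 2 statements merged into one kernel-verified Lean document; each statement's English description precedes it below -/
import Mathlib

section
/- Let T be a triangle with vertices x, y, z enclosing the origin, with all heights interior to the sides (case I), and let n₁ = n_{xy}, n₂ = n_{yz}, n₃ = n_{xz} be the feet of perpendiculars from the origin. Then the circular transform of T satisfies R_T = Φ_{‖n₁‖,‖x‖} + Φ_{‖n₁‖,‖y‖} + Φ_{‖n₂‖,‖y‖} + Φ_{‖n₂‖,‖z‖} + Φ_{‖n₃‖,‖x‖} + Φ_{‖n₃‖,‖z‖} on (0, ∞). -/
open Real MeasureTheory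

noncomputable abbrev E2 : Type := EuclideanSpace ℝ (Fin 2)

/-- The point `(a, b)` of the Euclidean plane. -/
noncomputable def pt2 (a b : ℝ) : E2 := (EuclideanSpace.equiv (Fin 2) ℝ).symm ![a, b]

/-- The circular transform of a set `S ⊆ ℝ²`: `R_S(ρ) = ∫₀^{2π} 1_S(ρ cos θ, ρ sin θ) dθ`. -/
noncomputable def circTransform (S : Set E2) (ρ : ℝ) : ℝ :=
  ∫ θ in (0 : ℝ)..(2 * π), S.indicator (fun _ => (1 : ℝ)) (pt2 (ρ * cos θ) (ρ * sin θ))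

/-- The right triangle `T(a,b) = conv((0,0), (a,0), (a, √(b² − a²)))`. -/
noncomputable def Tri (a b : ℝ) : Set E2 :=
  convexHull ℝ {pt2 0 0, pt2 a 0, pt2 a (Real.sqrt (b ^ 2 - a ^ 2))}

/-- `Φ_{a,b}`, the circular transform of the right triangle `T(a,b)`. -/
noncomputable def Phi (a b ρ : ℝ) : ℝ := circTransform (Tri a b) ρ

/-- `n` is the point of the line through `p` and `q` closest to the origin. -/
def IsFoot (p q n : E2) : Prop :=
  n ∈ affineSpan ℝ ({p, q} : Set E2) ∧
    ∀ m ∈ affineSpan ℝ ({p, q} : Set E2), ‖n‖ ≤ ‖m‖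

theorem pt2_zero (a b : ℝ) : pt2 a b 0 = a := rfl
theorem pt2_one (a b : ℝ) : pt2 a b 1 = b := rfl

theorem mem_convexHull_triple {u v w p : E2} :
    p ∈ convexHull ℝ {u, v, w} ↔
      ∃ a b c : ℝ, 0 ≤ a ∧ 0 ≤ b ∧ 0 ≤ c ∧ a + b + c = 1 ∧ a • u + b • v + c • w = p := by
  rw [convexHull_insert (by simp), convexHull_pair]
  simp only [mem_convexJoin, Set.mem_singleton_iff, exists_eq_left, segment, Set.mem_ofPred_eq]
  constructor
  · rintro ⟨_, ⟨b, c, hb, hc, hbc, rfl⟩, a, t, ha, ht, hat, rfl⟩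
    refine ⟨a, t * b, t * c, ha, by positivity, by positivity, by
      rw [add_assoc, ← mul_add, hbc, mul_one, hat], ?_⟩
    module
  · rintro ⟨a, b, c, ha, hb, hc, h, rfl⟩
    rcases (add_nonneg hb hc).eq_or_lt with h0 | h0
    · have hb0 : b = 0 := by linarith
      have hc0 : c = 0 := by linarith
      refine ⟨v, ⟨1, 0, by simp⟩, a, 0, ha, le_rfl, by linarith, ?_⟩
      simp [hb0, hc0]
    · refine ⟨_, ⟨b / (b + c), c / (b + c), by positivity, by positivity, by field_simp, rfl⟩,
        a, b + c, ha, h0.le, by linarith, ?_⟩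
      rw [smul_add, smul_smul, smul_smul, mul_div_cancel₀ _ h0.ne', mul_div_cancel₀ _ h0.ne', add_assoc]

theorem E2.ext' {p q : E2} (h0 : p 0 = q 0) (h1 : p 1 = q 1) : p = q := by
  ext i
  fin_cases i
  · exact h0
  · exact h1

theorem E2.norm_sq (p : E2) : ‖p‖ ^ 2 = p 0 ^ 2 + p 1 ^ 2 := by
  simp [EuclideanSpace.norm_sq_eq]

/-- Twice the oriented area of the triangle with vertices `u`, `v`, `w`. -/
noncomputable def area (u v w : E2) : ℝ :=
  (v 0 - u 0) * (w 1 - u 1) - (v 1 - u 1) * (w 0 - u 0)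

theorem mem_convexHull_triple_iff_area {u v w p : E2} (h : area u v w ≠ 0) :
    p ∈ convexHull ℝ {u, v, w} ↔ 0 ≤ area p v w * area u v w ∧
      0 ≤ area u p w * area u v w ∧ 0 ≤ area u v p * area u v w := by
  rw [mem_convexHull_triple]
  constructor
  · rintro ⟨a, b, c, ha, hb, hc, habc, rfl⟩
    have hc' : c = 1 - a - b := by linarith
    have e1 : area (a • u + b • v + c • w) v w = a * area u v w := by
      subst hc'; simp [area]; ring
    have e2 : area u (a • u + b • v + c • w) w = b * area u v w := by
      subst hc'; simp [area]; ring
    have e3 : area u v (a • u + b • v + c • w) = c * area u v w := by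
      obtain rfl : a = 1 - b - c := by linarith
      simp [area]; ring
    rw [e1, e2, e3, mul_assoc, mul_assoc, mul_assoc]
    have := mul_self_nonneg (area u v w)
    exact ⟨mul_nonneg ha this, mul_nonneg hb this, mul_nonneg hc this⟩
  · rintro ⟨h1, h2, h3⟩
    have key : ∀ t : ℝ, 0 ≤ t * area u v w → 0 ≤ t / area u v w := fun t ht => by
      rw [← mul_div_mul_right t _ h]
      exact div_nonneg ht (mul_self_nonneg _)
    refine ⟨_, _, _, key _ h1, key _ h2, key _ h3, ?_, ?_⟩
    · field_simp
      simp only [area]; ring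
    · apply E2.ext'
      · simp only [PiLp.add_apply, PiLp.smul_apply, smul_eq_mul]
        field_simp
        simp only [area]; ring
      · simp only [PiLp.add_apply, PiLp.smul_apply, smul_eq_mul]
        field_simp
        simp only [area]; ring

/-- Rotation of the plane by the angle `α`. -/
noncomputable def planeRotation (α : ℝ) : E2 →ₗ[ℝ] E2 where
  toFun p := pt2 (cos α * p 0 - sin α * p 1) (sin α * p 0 + cos α * p 1)
  map_add' p q := by apply E2.ext' <;> simp [pt2_zero, pt2_one] <;> ring
  map_smul' c p := by apply E2.ext' <;> simp [pt2_zero, pt2_one] <;> ring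

/-- Reflection of the plane in the first coordinate axis. -/
noncomputable def planeReflection : E2 →ₗ[ℝ] E2 where
  toFun p := pt2 (p 0) (-p 1)
  map_add' p q := by apply E2.ext' <;> simp [pt2_zero, pt2_one, add_comm]
  map_smul' c p := by apply E2.ext' <;> simp [pt2_zero, pt2_one]

theorem planeRotation_apply (α : ℝ) (p : E2) :
    planeRotation α p = pt2 (cos α * p 0 - sin α * p 1) (sin α * p 0 + cos α * p 1) := rfl

theorem planeReflection_apply (p : E2) : planeReflection p = pt2 (p 0) (-p 1) := rfl

theorem planeRotation_injective (α : ℝ) : Function.Injective (planeRotation α) := by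
  intro p q h
  have h0 : cos α * p 0 - sin α * p 1 = cos α * q 0 - sin α * q 1 := congrArg (fun r : E2 => r 0) h
  have h1 : sin α * p 0 + cos α * p 1 = sin α * q 0 + cos α * q 1 := congrArg (fun r : E2 => r 1) h
  apply E2.ext'
  · linear_combination cos α * h0 + sin α * h1 - (p 0 - q 0) * sin_sq_add_cos_sq α
  · linear_combination cos α * h1 - sin α * h0 - (p 1 - q 1) * sin_sq_add_cos_sq α

theorem planeReflection_injective : Function.Injective planeReflection := by
  intro p q h
  have h0 : p 0 = q 0 := by
    simpa [planeReflection_apply, pt2_zero] using congrArg (fun r : E2 => r 0) h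
  have h1 : p 1 = q 1 := by
    simpa [planeReflection_apply, pt2_one] using congrArg (fun r : E2 => r 1) h
  exact E2.ext' h0 h1

theorem periodic_indicator_circle (S : Set E2) (ρ : ℝ) :
    Function.Periodic
      (fun θ => S.indicator (fun _ => (1 : ℝ)) (pt2 (ρ * cos θ) (ρ * sin θ))) (2 * π) := by
  intro θ
  simp only [cos_add_two_pi, sin_add_two_pi]

theorem circTransform_image_rotation (S : Set E2) (α ρ : ℝ) :
    circTransform (planeRotation α '' S) ρ = circTransform S ρ := by
  have h (θ : ℝ) : (planeRotation α '' S).indicator (fun _ => (1 : ℝ)) (pt2 (ρ * cos θ) (ρ * sin θ)) =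
      S.indicator (fun _ => (1 : ℝ)) (pt2 (ρ * cos (θ - α)) (ρ * sin (θ - α))) := by
    have e : pt2 (ρ * cos θ) (ρ * sin θ) =
        planeRotation α (pt2 (ρ * cos (θ - α)) (ρ * sin (θ - α))) := by
      rw [planeRotation_apply]
      apply E2.ext' <;> simp only [pt2_zero, pt2_one]
      · nth_rewrite 1 [← sub_add_cancel θ α]
        rw [cos_add]; ring
      · nth_rewrite 1 [← sub_add_cancel θ α]
        rw [sin_add]; ring
    rw [e, Set.indicator_image (planeRotation_injective α)]
    rfl
  simp only [circTransform, h]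
  rw [intervalIntegral.integral_comp_sub_right
    (fun θ => S.indicator (fun _ => (1 : ℝ)) (pt2 (ρ * cos θ) (ρ * sin θ))) α]
  have := (periodic_indicator_circle S ρ).intervalIntegral_add_eq (0 - α) 0
  rwa [zero_add, zero_sub, neg_add_eq_sub, ← zero_sub] at this

theorem circTransform_image_reflection (S : Set E2) (ρ : ℝ) :
    circTransform (planeReflection '' S) ρ = circTransform S ρ := by
  have h (θ : ℝ) : (planeReflection '' S).indicator (fun _ => (1 : ℝ)) (pt2 (ρ * cos θ) (ρ * sin θ)) =
      S.indicator (fun _ => (1 : ℝ)) (pt2 (ρ * cos (-θ)) (ρ * sin (-θ))) := by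
    have e : pt2 (ρ * cos θ) (ρ * sin θ) =
        planeReflection (pt2 (ρ * cos (-θ)) (ρ * sin (-θ))) := by
      rw [planeReflection_apply]
      apply E2.ext' <;> simp [pt2_zero, pt2_one]
    rw [e, Set.indicator_image planeReflection_injective]
    rfl
  simp only [circTransform, h]
  rw [intervalIntegral.integral_comp_neg
    (fun θ => S.indicator (fun _ => (1 : ℝ)) (pt2 (ρ * cos θ) (ρ * sin θ)))]
  have := (periodic_indicator_circle S ρ).intervalIntegral_add_eq (-(2 * π)) 0
  simpa using this

theorem exists_polar (n : E2) : ∃ α, n 0 = ‖n‖ * cos α ∧ n 1 = ‖n‖ * sin α := by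
  have h : ‖n‖ = ‖(⟨n 0, n 1⟩ : ℂ)‖ := by
    rw [← sq_eq_sq₀ (norm_nonneg _) (norm_nonneg _), E2.norm_sq, Complex.sq_norm,
      Complex.normSq_apply]
    ring
  refine ⟨Complex.arg ⟨n 0, n 1⟩, ?_, ?_⟩
  · rw [h, Complex.norm_mul_cos_arg]
  · rw [h, Complex.norm_mul_sin_arg]

theorem circTransform_right_triangle {n v : E2} (hn : n ≠ 0)
    (h : n 0 * v 0 + n 1 * v 1 = n 0 ^ 2 + n 1 ^ 2) (ρ : ℝ) :
    circTransform (convexHull ℝ {0, n, v}) ρ = Phi ‖n‖ ‖v‖ ρ := by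
  obtain ⟨α, h0, h1⟩ := exists_polar n
  have hpos : ‖n‖ ≠ 0 := norm_ne_zero_iff.mpr hn
  set k : ℝ := cos α * v 1 - sin α * v 0 with hk
  have hca : cos α * v 0 + sin α * v 1 = ‖n‖ := by
    apply mul_left_cancel₀ hpos
    rw [← sq, E2.norm_sq]
    linear_combination h - v 0 * h0 - v 1 * h1
  have hv0 : v 0 = ‖n‖ * cos α - k * sin α := by
    rw [hk, ← hca]; linear_combination - v 0 * sin_sq_add_cos_sq α
  have hv1 : v 1 = ‖n‖ * sin α + k * cos α := by
    rw [hk, ← hca]; linear_combination - v 1 * sin_sq_add_cos_sq α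
  have hsq : √(‖v‖ ^ 2 - ‖n‖ ^ 2) = |k| := by
    rw [← sqrt_sq_eq_abs]
    congr 1
    rw [E2.norm_sq v, hv0, hv1]
    linear_combination (‖n‖ ^ 2 + k ^ 2) * sin_sq_add_cos_sq α
  rw [Phi, Tri, hsq]
  symm
  rcases le_total 0 k with hk0 | hk0
  · rw [abs_of_nonneg hk0, ← circTransform_image_rotation _ α, LinearMap.image_convexHull]
    congr 3
    simp only [Set.image_insert_eq, Set.image_singleton, planeRotation_apply, pt2_zero, pt2_one]
    congr 1
    · apply E2.ext' <;> simp [pt2_zero, pt2_one]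
    congr 1
    · apply E2.ext' <;> simp only [pt2_zero, pt2_one]
      · rw [h0]; ring
      · rw [h1]; ring
    congr 1
    apply E2.ext' <;> simp only [pt2_zero, pt2_one]
    · rw [hv0]; ring
    · rw [hv1]; ring
  · rw [abs_of_nonpos hk0, ← circTransform_image_reflection, ← circTransform_image_rotation _ α,
      LinearMap.image_convexHull, LinearMap.image_convexHull]
    congr 3
    simp only [Set.image_insert_eq, Set.image_singleton, planeRotation_apply, planeReflection_apply,
      pt2_zero, pt2_one]
    congr 1
    · apply E2.ext' <;> simp [pt2_zero, pt2_one]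
    congr 1
    · apply E2.ext' <;> simp only [pt2_zero, pt2_one]
      · rw [h0]; ring
      · rw [h1]; ring
    congr 1
    apply E2.ext' <;> simp only [pt2_zero, pt2_one]
    · rw [hv0]; ring
    · rw [hv1]; ring

theorem continuous_pt2 : Continuous fun q : ℝ × ℝ => pt2 q.1 q.2 := by
  unfold pt2
  fun_prop

theorem intervalIntegrable_indicator_circle {S : Set E2} (hS : IsClosed S) (ρ : ℝ) :
    IntervalIntegrable (fun θ => S.indicator (fun _ => (1 : ℝ)) (pt2 (ρ * cos θ) (ρ * sin θ)))
      volume 0 (2 * π) := by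
  have hc : Continuous fun θ : ℝ => pt2 (ρ * cos θ) (ρ * sin θ) :=
    continuous_pt2.comp (by fun_prop : Continuous fun θ : ℝ => (ρ * cos θ, ρ * sin θ))
  have hm : MeasurableSet ((fun θ : ℝ => pt2 (ρ * cos θ) (ρ * sin θ)) ⁻¹' S) :=
    (hS.preimage hc).measurableSet
  have h1 : IntervalIntegrable (fun _ : ℝ => (1 : ℝ)) volume 0 (2 * π) := by simp
  exact ⟨h1.1.indicator hm, h1.2.indicator hm⟩

theorem isClosed_convexHull_triple (u v w : E2) : IsClosed (convexHull ℝ {u, v, w}) :=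
  Set.Finite.isClosed_convexHull ℝ (Set.toFinite _)

theorem ae_area_circle_ne_zero {v : E2} (hv : v ≠ 0) {ρ : ℝ} (hρ : 0 < ρ) :
    ∀ᵐ θ : ℝ, area 0 v (pt2 (ρ * cos θ) (ρ * sin θ)) ≠ 0 := by
  obtain ⟨α, h0, h1⟩ := exists_polar v
  refine Set.Countable.ae_notMem (s := Set.range fun k : ℤ => k * π + α)
    (Set.countable_range _) volume |>.mono fun θ hθ h => hθ ?_
  have : ‖v‖ * ρ * sin (θ - α) = 0 := by
    rw [← h, sin_sub]
    simp only [area, pt2_zero, pt2_one, PiLp.zero_apply]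
    rw [h0, h1]; ring
  have h2 : sin (θ - α) = 0 := by
    simpa [hρ.ne', norm_ne_zero_iff.mpr hv] using this
  obtain ⟨k, hk⟩ := sin_eq_zero_iff.mp h2
  exact ⟨k, by simp only; linarith⟩

theorem area_split_identity {x y n p : E2} {s : ℝ} (hn : n = s • x + (1 - s) • y) :
    area 0 n x = -(1 - s) * area 0 x y ∧ area 0 n y = s * area 0 x y ∧
      area p n x = -(1 - s) * area p x y ∧ area p n y = s * area p x y ∧
      area 0 n p = s * area 0 x p - (1 - s) * area 0 p y := by
  subst hn
  refine ⟨?_, ?_, ?_, ?_, ?_⟩ <;> simp [area] <;> ring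

open scoped Classical in
theorem indicator_convexHull_split {x y n p : E2} {s : ℝ} (hs : s ∈ Set.Ioo (0 : ℝ) 1)
    (hn : n = s • x + (1 - s) • y) (hD : area 0 x y ≠ 0) (hp : area 0 n p ≠ 0) :
    (convexHull ℝ {0, x, y}).indicator (fun _ => (1 : ℝ)) p =
      (convexHull ℝ {0, n, x}).indicator (fun _ => (1 : ℝ)) p +
        (convexHull ℝ {0, n, y}).indicator (fun _ => (1 : ℝ)) p := by
  obtain ⟨hs0, hs1⟩ := hs
  have hs1' : 0 < 1 - s := by linarith
  obtain ⟨e1, e2, e3, e4, e5⟩ := area_split_identity (p := p) hn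
  have hx : area 0 n x ≠ 0 := by rw [e1]; exact mul_ne_zero (neg_ne_zero.mpr hs1'.ne') hD
  have hy : area 0 n y ≠ 0 := by rw [e2]; exact mul_ne_zero hs0.ne' hD
  simp only [Set.indicator_apply, mem_convexHull_triple_iff_area hD,
    mem_convexHull_triple_iff_area hx, mem_convexHull_triple_iff_area hy]
  have e6 : area 0 p x = -area 0 x p := by simp [area]; ring
  have hne : s * (area 0 x p * area 0 x y) - (1 - s) * (area 0 p y * area 0 x y) ≠ 0 := by
    have := mul_ne_zero hp hD
    rw [e5] at this
    intro h; apply this; linear_combination h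
  rw [e1, e2, e3, e4, e5, e6]
  set P := area p x y * area 0 x y with hP
  set U := area 0 p y * area 0 x y with hU
  set V := area 0 x p * area 0 x y with hV
  have f1 : -(1 - s) * area p x y * (-(1 - s) * area 0 x y) = (1 - s) * (1 - s) * P := by
    rw [hP]; ring
  have f2 : -area 0 x p * (-(1 - s) * area 0 x y) = (1 - s) * V := by rw [hV]; ring
  have f3 : (s * area 0 x p - (1 - s) * area 0 p y) * (-(1 - s) * area 0 x y) =
      (1 - s) * -(s * V - (1 - s) * U) := by rw [hU, hV]; ring
  have f4 : s * area p x y * (s * area 0 x y) = s * s * P := by rw [hP]; ring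
  have f5 : area 0 p y * (s * area 0 x y) = s * U := by rw [hU]; ring
  have f6 : (s * area 0 x p - (1 - s) * area 0 p y) * (s * area 0 x y) =
      s * (s * V - (1 - s) * U) := by rw [hU, hV]; ring
  rw [f1, f2, f3, f4, f5, f6]
  simp only [mul_nonneg_iff_of_pos_left (mul_pos hs1' hs1'), mul_nonneg_iff_of_pos_left hs1',
    mul_nonneg_iff_of_pos_left (mul_pos hs0 hs0), mul_nonneg_iff_of_pos_left hs0]
  by_cases hP0 : 0 ≤ P
  · rcases lt_or_gt_of_ne hne with h | h
    · have hU' : 0 ≤ V → 0 ≤ U := fun hV0 => by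
        have := mul_nonneg hs0.le hV0
        exact ((mul_pos_iff_of_pos_left hs1').mp (by linarith)).le
      have a1 : 0 ≤ -(s * V - (1 - s) * U) := by linarith
      have a2 : ¬ 0 ≤ s * V - (1 - s) * U := by linarith
      by_cases hV0 : 0 ≤ V
      · simp [hP0, a1, a2, hV0, hU' hV0, -neg_sub]
      · simp [hP0, a2, hV0]
    · have hV' : 0 ≤ U → 0 ≤ V := fun hU0 => by
        have := mul_nonneg hs1'.le hU0
        exact ((mul_pos_iff_of_pos_left hs0).mp (by linarith)).le
      have a1 : ¬ 0 ≤ -(s * V - (1 - s) * U) := by linarith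
      have a2 : 0 ≤ s * V - (1 - s) * U := by linarith
      by_cases hU0 : 0 ≤ U
      · simp [hP0, a1, a2, hU0, hV' hU0, -neg_sub, -sub_nonneg]
      · simp [hP0, a1, hU0, -neg_sub]
  · simp [hP0]

theorem circTransform_split_side {x y n : E2} {s : ℝ} (hs : s ∈ Set.Ioo (0 : ℝ) 1)
    (hn : n = s • x + (1 - s) • y) (hD : area 0 x y ≠ 0) (hn0 : n ≠ 0) {ρ : ℝ} (hρ : 0 < ρ) :
    circTransform (convexHull ℝ {0, x, y}) ρ =
      circTransform (convexHull ℝ {0, n, x}) ρ + circTransform (convexHull ℝ {0, n, y}) ρ := by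
  simp only [circTransform]
  rw [← intervalIntegral.integral_add
    (intervalIntegrable_indicator_circle (isClosed_convexHull_triple _ _ _) ρ)
    (intervalIntegrable_indicator_circle (isClosed_convexHull_triple _ _ _) ρ)]
  refine intervalIntegral.integral_congr_ae ?_
  filter_upwards [ae_area_circle_ne_zero hn0 hρ] with θ hθ _
  exact indicator_convexHull_split hs hn hD hθ

theorem IsFoot.orthogonal {x y n : E2} (h : IsFoot x y n) :
    n 0 * (x 0 - y 0) + n 1 * (x 1 - y 1) = 0 := by
  obtain ⟨hn, hmin⟩ := h
  set i := n 0 * (x 0 - y 0) + n 1 * (x 1 - y 1) with hi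
  set d := (x 0 - y 0) ^ 2 + (x 1 - y 1) ^ 2 with hd
  have key (t : ℝ) : 0 ≤ 2 * t * i + t ^ 2 * d := by
    have hm : t • (x - y) + n ∈ affineSpan ℝ ({x, y} : Set E2) :=
      AffineSubspace.vadd_mem_of_mem_direction
        (Submodule.smul_mem _ _ (AffineSubspace.vsub_mem_direction
          (left_mem_affineSpan_pair ℝ x y) (right_mem_affineSpan_pair ℝ x y))) hn
    have := pow_le_pow_left₀ (norm_nonneg _) (hmin _ hm) 2
    rw [E2.norm_sq, E2.norm_sq] at this
    simp only [PiLp.add_apply, PiLp.smul_apply, PiLp.sub_apply, smul_eq_mul] at this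
    rw [hi, hd]
    linarith
  have hd0 : 0 ≤ d := by positivity
  have h1 := key (-(i / (d + 1)))
  have h2 : 2 * -(i / (d + 1)) * i + (-(i / (d + 1))) ^ 2 * d =
      -(i ^ 2 * (d + 2) / (d + 1) ^ 2) := by field_simp; ring
  rw [h2] at h1
  have h3 : i ^ 2 * (d + 2) / (d + 1) ^ 2 = 0 := le_antisymm (by linarith) (by positivity)
  have h4 : d + 2 ≠ 0 := by positivity
  have h5 : d + 1 ≠ 0 := by positivity
  simpa [h4, h5] using h3

theorem circTransform_side {x y n : E2} (h : IsFoot x y n)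
    (hs : ∃ s ∈ Set.Ioo (0 : ℝ) 1, n = s • x + (1 - s) • y) (hD : area 0 x y ≠ 0)
    {ρ : ℝ} (hρ : 0 < ρ) :
    circTransform (convexHull ℝ {0, x, y}) ρ = Phi ‖n‖ ‖x‖ ρ + Phi ‖n‖ ‖y‖ ρ := by
  obtain ⟨s, hs, hn⟩ := hs
  have hn0 : n ≠ 0 := by
    rintro rfl
    have h1 := (area_split_identity (p := 0) hn).2.1
    have h2 : area 0 0 y = 0 := by simp [area]
    rw [h2] at h1
    exact mul_ne_zero hs.1.ne' hD h1.symm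
  have ho := h.orthogonal
  have n0 : n 0 = s * x 0 + (1 - s) * y 0 := by rw [hn]; simp
  have n1 : n 1 = s * x 1 + (1 - s) * y 1 := by rw [hn]; simp
  rw [circTransform_split_side hs hn hD hn0 hρ, circTransform_right_triangle hn0,
    circTransform_right_triangle hn0]
  · linear_combination -n 0 * n0 - n 1 * n1 - s * ho
  · linear_combination -n 0 * n0 - n 1 * n1 + (1 - s) * ho

theorem area_rotate (x y z : E2) : area y z x = area x y z := by
  simp only [area]; ring

theorem area_zero_eq_mul {x y z : E2} {α β γ : ℝ} (hsum : α + β + γ = 1)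
    (h0 : α • x + β • y + γ • z = 0) : area 0 x y = γ * area x y z := by
  have e0 : α * x 0 + β * y 0 + γ * z 0 = 0 := by simpa using congrArg (fun r : E2 => r 0) h0
  have e1 : α * x 1 + β * y 1 + γ * z 1 = 0 := by simpa using congrArg (fun r : E2 => r 1) h0
  simp only [area, PiLp.zero_apply]
  linear_combination (y 1 - x 1) * e0 + (x 0 - y 0) * e1 - (x 0 * y 1 - x 1 * y 0) * hsum

theorem area_sector {x y z : E2} {α β γ : ℝ} (hsum : α + β + γ = 1)
    (h0 : α • x + β • y + γ • z = 0) (p : E2) :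
    area 0 p y = γ * area p y z - α * area x y p ∧
      area 0 x p = γ * area x p z - β * area x y p := by
  have e0 : α * x 0 + β * y 0 + γ * z 0 = 0 := by simpa using congrArg (fun r : E2 => r 0) h0
  have e1 : α * x 1 + β * y 1 + γ * z 1 = 0 := by simpa using congrArg (fun r : E2 => r 1) h0
  simp only [area, PiLp.zero_apply]
  constructor
  · linear_combination (y 1 - p 1) * e0 + (p 0 - y 0) * e1 - (p 0 * y 1 - p 1 * y 0) * hsum
  · linear_combination (p 1 - x 1) * e0 + (x 0 - p 0) * e1 - (x 0 * p 1 - x 1 * p 0) * hsum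

theorem mem_convexHull_sector_iff {x y z p : E2} {α β γ : ℝ} (hα : 0 < α) (hβ : 0 < β)
    (hγ : 0 < γ) (hsum : α + β + γ = 1) (h0 : α • x + β • y + γ • z = 0)
    (hE : area x y z ≠ 0) :
    p ∈ convexHull ℝ {0, x, y} ↔
      0 ≤ area x y p * area x y z / γ ∧
        area x y p * area x y z / γ ≤ area p y z * area x y z / α ∧
        area x y p * area x y z / γ ≤ area x p z * area x y z / β := by
  obtain ⟨h1, h2⟩ := area_sector hsum h0 p
  rw [mem_convexHull_triple_iff_area
      (by rw [area_zero_eq_mul hsum h0]; exact mul_ne_zero hγ.ne' hE),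
    area_zero_eq_mul hsum h0, h1, h2, ← area_rotate p x y]
  refine and_congr ?_ (and_congr ?_ ?_)
  · rw [mul_left_comm, mul_nonneg_iff_of_pos_left hγ, le_div_iff₀ hγ, zero_mul]
  · rw [div_le_div_iff₀ hγ hα, mul_left_comm, mul_nonneg_iff_of_pos_left hγ,
      ← sub_nonneg (b := _ * α)]
    ring_nf
  · rw [div_le_div_iff₀ hγ hβ, mul_left_comm, mul_nonneg_iff_of_pos_left hγ,
      ← sub_nonneg (b := _ * β)]
    ring_nf

theorem indicator_sum_of_distinct {a b c : ℝ} (hab : a ≠ b) (hbc : b ≠ c) (hca : c ≠ a) :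
    (if 0 ≤ a ∧ 0 ≤ b ∧ 0 ≤ c then (1 : ℝ) else 0) =
      (if 0 ≤ c ∧ c ≤ a ∧ c ≤ b then 1 else 0) + (if 0 ≤ a ∧ a ≤ b ∧ a ≤ c then 1 else 0) +
        (if 0 ≤ b ∧ b ≤ c ∧ b ≤ a then 1 else 0) := by
  grind

open scoped Classical in
theorem indicator_convexHull_split_center {x y z p : E2} {α β γ : ℝ} (hα : 0 < α) (hβ : 0 < β)
    (hγ : 0 < γ) (hsum : α + β + γ = 1) (h0 : α • x + β • y + γ • z = 0)
    (hE : area x y z ≠ 0) (hx : area 0 x p ≠ 0) (hy : area 0 y p ≠ 0) (hz : area 0 z p ≠ 0) :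
    (convexHull ℝ {x, y, z}).indicator (fun _ => (1 : ℝ)) p =
      (convexHull ℝ {0, x, y}).indicator (fun _ => (1 : ℝ)) p +
        (convexHull ℝ {0, y, z}).indicator (fun _ => (1 : ℝ)) p +
          (convexHull ℝ {0, x, z}).indicator (fun _ => (1 : ℝ)) p := by
  have hE1 : area y z x ≠ 0 := by rwa [area_rotate]
  have hE2 : area z x y ≠ 0 := by rwa [area_rotate]
  have h1 : β • y + γ • z + α • x = 0 := by rw [← h0]; abel
  have h2 : γ • z + α • x + β • y = 0 := by rw [← h0]; abel
  have c0 := mem_convexHull_sector_iff (p := p) hα hβ hγ hsum h0 hE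
  have c1 := mem_convexHull_sector_iff (p := p) hβ hγ hα (by linarith) h1 hE1
  have c2 := mem_convexHull_sector_iff (p := p) hγ hα hβ (by linarith) h2 hE2
  have r1 : area y z p = area p y z := area_rotate p y z
  have r2 : area p z x = area x p z := area_rotate x p z
  have r3 : area y p x = area x y p := area_rotate x y p
  have r4 : area z x p = area x p z := by rw [area_rotate p z x, r2]
  have r5 : area p x y = area x y p := by rw [← r3, area_rotate]
  have r6 : area z p y = area p y z := (area_rotate y z p).trans r1
  have r7 : area y z x = area x y z := area_rotate x y z
  have r8 : area z x y = area x y z := by rw [← r7, area_rotate]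
  rw [r1, r2, r3, r7] at c1
  rw [r4, r5, r6, r8, Set.pair_comm z x] at c2
  simp only [Set.indicator_apply, c0, c1, c2, mem_convexHull_triple_iff_area hE]
  obtain ⟨a1, a2⟩ := area_sector hsum h0 p
  obtain ⟨-, a3⟩ := area_sector (by linarith) h2 p
  have d1 : area 0 p y = - area 0 y p := by simp only [area, PiLp.zero_apply]; ring
  rw [← indicator_sum_of_distinct]
  · simp only [le_div_iff₀ hα, le_div_iff₀ hβ, le_div_iff₀ hγ, zero_mul]
  · intro h
    rw [div_eq_div_iff hα.ne' hβ.ne'] at h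
    refine mul_ne_zero hz hE ?_
    rw [a3, r6, r4]
    linear_combination h
  · intro h
    rw [div_eq_div_iff hβ.ne' hγ.ne'] at h
    refine mul_ne_zero hx hE ?_
    rw [a2]
    linear_combination h
  · intro h
    rw [div_eq_div_iff hγ.ne' hα.ne'] at h
    refine mul_ne_zero hy hE ?_
    rw [← neg_eq_zero, ← neg_mul, ← d1, a1]
    linear_combination -h

theorem eq_zero_of_zero_mem_interior {x y z : E2}
    (hT : (0 : E2) ∈ interior (convexHull ℝ {x, y, z})) {a b : ℝ}
    (hx : 0 ≤ a * x 0 + b * x 1) (hy : 0 ≤ a * y 0 + b * y 1) (hz : 0 ≤ a * z 0 + b * z 1) :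
    a = 0 ∧ b = 0 := by
  have hc : Continuous fun t : ℝ => pt2 (-(t * a)) (-(t * b)) :=
    continuous_pt2.comp (by fun_prop : Continuous fun t : ℝ => (-(t * a), -(t * b)))
  have hz0 : pt2 (-(0 * a)) (-(0 * b)) = 0 := by apply E2.ext' <;> simp [pt2_zero, pt2_one]
  have hev : ∀ᶠ t in nhds (0 : ℝ), pt2 (-(t * a)) (-(t * b)) ∈ convexHull ℝ {x, y, z} := by
    apply hc.continuousAt.eventually_mem
    rw [hz0]
    exact mem_interior_iff_mem_nhds.mp hT
  obtain ⟨t, ht, ht0⟩ :=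
    ((hev.filter_mono nhdsWithin_le_nhds).and (self_mem_nhdsWithin (s := Set.Ioi (0 : ℝ)))).exists
  obtain ⟨u, v, w, hu, hv, hw, -, h⟩ := mem_convexHull_triple.mp ht
  have e0 : u * x 0 + v * y 0 + w * z 0 = -(t * a) := by
    simpa [pt2_zero] using congrArg (fun r : E2 => r 0) h
  have e1 : u * x 1 + v * y 1 + w * z 1 = -(t * b) := by
    simpa [pt2_one] using congrArg (fun r : E2 => r 1) h
  have ht0' : 0 < t := ht0
  have h1 : t * (a ^ 2 + b ^ 2) ≤ 0 := by
    have := add_nonneg (add_nonneg (mul_nonneg hu hx) (mul_nonneg hv hy)) (mul_nonneg hw hz)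
    linear_combination this + a * e0 + b * e1
  have h2 : a ^ 2 + b ^ 2 ≤ 0 := by
    by_contra! hlt
    exact absurd (mul_pos ht0' hlt) (not_lt.mpr h1)
  constructor <;> nlinarith [sq_nonneg a, sq_nonneg b]

theorem area_ne_zero_of_zero_mem_interior {x y z : E2}
    (hT : (0 : E2) ∈ interior (convexHull ℝ {x, y, z})) : area x y z ≠ 0 := by
  intro hE
  obtain ⟨u, v, w, hu, hv, hw, hs, h⟩ := mem_convexHull_triple.mp (interior_subset hT)
  have e0 : u * x 0 + v * y 0 + w * z 0 = 0 := by
    simpa using congrArg (fun r : E2 => r 0) h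
  have e1 : u * x 1 + v * y 1 + w * z 1 = 0 := by
    simpa using congrArg (fun r : E2 => r 1) h
  have hcol {a b t : ℝ} (hx : a * x 0 + b * x 1 = t) (hy : a * y 0 + b * y 1 = t)
      (hz : a * z 0 + b * z 1 = t) : a = 0 ∧ b = 0 := by
    have ht : t = 0 := by
      linear_combination a * e0 + b * e1 - u * hx - v * hy - w * hz - t * hs
    subst ht
    exact eq_zero_of_zero_mem_interior hT hx.ge hy.ge hz.ge
  simp only [area] at hE
  have h1 := hcol (a := y 1 - x 1) (b := x 0 - y 0) (t := (y 1 - x 1) * x 0 + (x 0 - y 0) * x 1)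
    rfl (by ring) (by linear_combination -hE)
  have h2 := hcol (a := z 1 - x 1) (b := x 0 - z 0) (t := (z 1 - x 1) * x 0 + (x 0 - z 0) * x 1)
    rfl (by linear_combination hE) (by ring)
  obtain ⟨f1, f2⟩ := h1
  obtain ⟨f3, f4⟩ := h2
  have h3 := hcol (a := 1) (b := 0) (t := x 0) (by ring) (by linear_combination -f2)
    (by linear_combination -f4)
  exact one_ne_zero h3.1

theorem exists_pos_barycentric_of_zero_mem_interior {x y z : E2}
    (hT : (0 : E2) ∈ interior (convexHull ℝ {x, y, z})) :
    ∃ α β γ : ℝ, 0 < α ∧ 0 < β ∧ 0 < γ ∧ α + β + γ = 1 ∧ α • x + β • y + γ • z = 0 := by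
  have hpos {x y z : E2} (hT : (0 : E2) ∈ interior (convexHull ℝ {x, y, z})) {u v w : ℝ}
      (hu : 0 ≤ u) (hs : u + v + w = 1) (h : u • x + v • y + w • z = 0) : 0 < u := by
    refine lt_of_le_of_ne hu fun hu0 => ?_
    subst hu0
    have hE := area_ne_zero_of_zero_mem_interior hT
    have e0 : v * y 0 + w * z 0 = 0 := by simpa using congrArg (fun r : E2 => r 0) h
    have e1 : v * y 1 + w * z 1 = 0 := by simpa using congrArg (fun r : E2 => r 1) h
    have hyz : y 0 * z 1 - y 1 * z 0 = 0 := by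
      linear_combination (z 1 - y 1) * e0 + (y 0 - z 0) * e1 - (y 0 * z 1 - y 1 * z 0) * hs
    have hcol := eq_zero_of_zero_mem_interior hT
      (a := (y 1 - z 1) * area x y z) (b := (z 0 - y 0) * area x y z)
      (by
        have hx : (y 1 - z 1) * x 0 + (z 0 - y 0) * x 1 = area x y z := by
          simp only [area]; linear_combination -hyz
        have : (y 1 - z 1) * area x y z * x 0 + (z 0 - y 0) * area x y z * x 1 =
            area x y z ^ 2 := by
          linear_combination area x y z * hx
        rw [this]; positivity)
      (by apply le_of_eq; linear_combination area x y z * hyz)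
      (by apply le_of_eq; linear_combination area x y z * hyz)
    obtain ⟨h1, h2⟩ := hcol
    have h1' := (mul_eq_zero_iff_right hE).mp h1
    have h2' := (mul_eq_zero_iff_right hE).mp h2
    apply hE
    simp only [area]
    linear_combination (x 0 - y 0) * h1' + (x 1 - y 1) * h2'
  obtain ⟨u, v, w, hu, hv, hw, hs, h⟩ := mem_convexHull_triple.mp (interior_subset hT)
  refine ⟨u, v, w, hpos hT hu hs h, ?_, ?_, hs, h⟩
  · rw [Set.insert_comm] at hT
    exact hpos hT (v := u) (w := w) hv (by linarith) (by rw [← h]; abel)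
  · rw [Set.pair_comm, Set.insert_comm] at hT
    exact hpos hT (v := u) (w := v) hw (by linarith) (by rw [← h]; abel)

theorem circTransform_split_center {x y z : E2} {α β γ : ℝ} (hα : 0 < α) (hβ : 0 < β)
    (hγ : 0 < γ) (hsum : α + β + γ = 1) (h0 : α • x + β • y + γ • z = 0)
    (hE : area x y z ≠ 0) (hx : x ≠ 0) (hy : y ≠ 0) (hz : z ≠ 0) {ρ : ℝ} (hρ : 0 < ρ) :
    circTransform (convexHull ℝ {x, y, z}) ρ =
      circTransform (convexHull ℝ {0, x, y}) ρ + circTransform (convexHull ℝ {0, y, z}) ρ +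
        circTransform (convexHull ℝ {0, x, z}) ρ := by
  have hi (u v : E2) := intervalIntegrable_indicator_circle (isClosed_convexHull_triple 0 u v) ρ
  simp only [circTransform]
  rw [← intervalIntegral.integral_add (hi _ _) (hi _ _),
    ← intervalIntegral.integral_add ((hi _ _).add (hi _ _)) (hi _ _)]
  refine intervalIntegral.integral_congr_ae ?_
  filter_upwards [ae_area_circle_ne_zero hx hρ, ae_area_circle_ne_zero hy hρ,
    ae_area_circle_ne_zero hz hρ] with θ h1 h2 h3 _
  exact indicator_convexHull_split_center hα hβ hγ hsum h0 hE h1 h2 h3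

/-- Case I: if the triangle `T = conv(x,y,z)` encloses the origin and all three feet of
perpendiculars from the origin lie in the interiors of the corresponding sides, then on
`(0, ∞)` the circular transform of `T` decomposes as
`R_T = Φ_{‖n₁‖,‖x‖} + Φ_{‖n₁‖,‖y‖} + Φ_{‖n₂‖,‖y‖} + Φ_{‖n₂‖,‖z‖} + Φ_{‖n₃‖,‖x‖} + Φ_{‖n₃‖,‖z‖}`. -/
theorem stmt_18 (x y z n₁ n₂ n₃ : E2)
    (hT : (0 : E2) ∈ interior (convexHull ℝ {x, y, z}))
    (h₁ : IsFoot x y n₁) (h₂ : IsFoot y z n₂) (h₃ : IsFoot x z n₃)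
    (hs₁ : ∃ s ∈ Set.Ioo (0 : ℝ) 1, n₁ = s • x + (1 - s) • y)
    (hs₂ : ∃ s ∈ Set.Ioo (0 : ℝ) 1, n₂ = s • y + (1 - s) • z)
    (hs₃ : ∃ s ∈ Set.Ioo (0 : ℝ) 1, n₃ = s • x + (1 - s) • z) :
    ∀ ρ : ℝ, 0 < ρ →
      circTransform (convexHull ℝ {x, y, z}) ρ =
        Phi ‖n₁‖ ‖x‖ ρ + Phi ‖n₁‖ ‖y‖ ρ + Phi ‖n₂‖ ‖y‖ ρ +
        Phi ‖n₂‖ ‖z‖ ρ + Phi ‖n₃‖ ‖x‖ ρ + Phi ‖n₃‖ ‖z‖ ρ := by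
  intro ρ hρ
  have hE := area_ne_zero_of_zero_mem_interior hT
  obtain ⟨α, β, γ, hα, hβ, hγ, hsum, h0⟩ := exists_pos_barycentric_of_zero_mem_interior hT
  have hxy : area 0 x y ≠ 0 := by
    rw [area_zero_eq_mul hsum h0]; exact mul_ne_zero hγ.ne' hE
  have hyz : area 0 y z ≠ 0 := by
    rw [area_zero_eq_mul (z := x) (γ := α) (α := β) (β := γ) (by linarith) (by rw [← h0]; abel),
      area_rotate]
    exact mul_ne_zero hα.ne' hE
  have hxz : area 0 x z ≠ 0 := by
    have h : area x z y = -area x y z := by simp only [area]; ring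
    rw [area_zero_eq_mul (z := y) (γ := β) (α := α) (β := γ) (by linarith) (by rw [← h0]; abel), h]
    exact mul_ne_zero hβ.ne' (neg_ne_zero.mpr hE)
  have hx : x ≠ 0 := by rintro rfl; simp [area] at hxy
  have hy : y ≠ 0 := by rintro rfl; simp [area] at hxy
  have hz : z ≠ 0 := by rintro rfl; simp [area] at hyz
  rw [circTransform_split_center hα hβ hγ hsum h0 hE hx hy hz hρ, circTransform_side h₁ hs₁ hxy hρ,
    circTransform_side h₂ hs₂ hyz hρ, circTransform_side h₃ hs₃ hxz hρ]
  ring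
end

section
/- If T and T' are triangles in ℝ², each containing the origin in its interior, and their circular transforms coincide (R_T(ρ) = R_{T'}(ρ) for all ρ > 0), then there exists an orthogonal transformation O of ℝ² with O(T) = T'. -/
open Real MeasureTheory

open Filter Topology

theorem analyticAt_inv_sqrt_sq_sub_sq {a ρ : ℝ} (ha : 0 < a) (h : a < ρ) :
    AnalyticAt ℝ (fun r : ℝ => (√(r ^ 2 - a ^ 2))⁻¹) ρ := by
  have hpos : 0 < ρ ^ 2 - a ^ 2 := by nlinarith
  have h1 : AnalyticAt ℝ (fun r : ℝ => √(r ^ 2 - a ^ 2)) ρ := by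
    refine AnalyticAt.fun_comp (g := Real.sqrt) (f := fun r : ℝ => r ^ 2 - a ^ 2) ?_ (by fun_prop)
    exact (Real.contDiffAt_sqrt (n := ⊤) hpos.ne').analyticAt
  exact h1.inv (Real.sqrt_pos.2 hpos).ne'

/-- The functions `r ↦ (r² - a²)^(-1/2)`, `a > 0`, are linearly independent as germs. -/
theorem eq_zero_of_sum_inv_sqrt_eq_zero (D : Finset ℝ) (e : ℝ → ℝ) (ρ : ℝ)
    (hD : ∀ a ∈ D, 0 < a ∧ a < ρ)
    (h : ∀ᶠ r in 𝓝 ρ, ∑ a ∈ D, e a * (√(r ^ 2 - a ^ 2))⁻¹ = 0) :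
    ∀ a ∈ D, e a = 0 := by
  induction D using Finset.induction_on_max with
  | empty => simp
  | insert m D hm ih =>
    have hmD : m ∉ D := fun hmem => lt_irrefl _ (hm m hmem)
    obtain ⟨hm0, hmρ⟩ := hD m (by simp)
    have han : AnalyticOnNhd ℝ
        (fun r : ℝ => ∑ a ∈ insert m D, e a * (√(r ^ 2 - a ^ 2))⁻¹) (Set.Ioi m) := by
      intro r hr
      refine Finset.analyticAt_fun_sum _ fun a ha => ?_
      refine analyticAt_const.mul (analyticAt_inv_sqrt_sq_sub_sq (hD a ha).1 ?_)
      rcases Finset.mem_insert.1 ha with rfl | ha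
      · exact hr
      · exact (hm a ha).trans hr
    have hzero := han.eqOn_zero_of_preconnected_of_eventuallyEq_zero isPreconnected_Ioi hmρ h
    have hem : e m = 0 := by
      have hcont : ContinuousAt (fun r : ℝ =>
          e m + ∑ a ∈ D, e a * (√(r ^ 2 - a ^ 2))⁻¹ * √(r ^ 2 - m ^ 2)) m := by
        refine continuousAt_const.add (tendsto_finsetSum _ fun a ha => ?_)
        have := (analyticAt_inv_sqrt_sq_sub_sq (hD a (by simp [ha])).1 (hm a ha)).continuousAt
        exact (continuousAt_const.mul this).mul (by fun_prop)
      have hev : ∀ᶠ r in 𝓝[>] m,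
          (fun r : ℝ => e m + ∑ a ∈ D, e a * (√(r ^ 2 - a ^ 2))⁻¹ * √(r ^ 2 - m ^ 2)) r = 0 := by
        filter_upwards [self_mem_nhdsWithin] with r hr
        have hr' : m < r := hr
        have hpos : 0 < √(r ^ 2 - m ^ 2) := Real.sqrt_pos.2 (by nlinarith)
        have h0 := hzero hr
        simp only [Finset.sum_insert hmD, Pi.zero_apply] at h0
        rw [← Finset.sum_mul]
        calc _ = (e m * (√(r ^ 2 - m ^ 2))⁻¹ + ∑ a ∈ D, e a * (√(r ^ 2 - a ^ 2))⁻¹)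
              * √(r ^ 2 - m ^ 2) := by field_simp
          _ = 0 := by rw [h0, zero_mul]
      have hlim := tendsto_nhds_unique
        (hcont.tendsto.mono_left (nhdsWithin_le_nhds (s := Set.Ioi m)))
        (tendsto_const_nhds.congr' (hev.mono fun r hr => hr.symm))
      simpa using hlim
    have := ih (fun a ha => hD a (by simp [ha])) (by
      filter_upwards [h] with r hr
      simpa [Finset.sum_insert hmD, hem] using hr)
    intro a ha
    rcases Finset.mem_insert.1 ha with rfl | ha
    · exact hem
    · exact this a ha

theorem div_lt_div_cos_iff {D t T : ℝ} (hD : 0 < D) (ht0 : 0 ≤ t) (ht : t < π / 2)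
    (hT0 : 0 ≤ T) (hT : T < π / 2) : D / cos t < D / cos T ↔ t < T := by
  have hct : 0 < cos t := cos_pos_of_mem_Ioo ⟨by linarith, ht⟩
  have hcT : 0 < cos T := cos_pos_of_mem_Ioo ⟨by linarith, hT⟩
  rw [div_lt_div_iff_of_pos_left hD hct hcT]
  exact strictAntiOn_cos.lt_iff_gt ⟨by linarith, by linarith⟩ ⟨by linarith, by linarith⟩

theorem lt_arccos_iff_cos_gt {x t : ℝ} (hx0 : 0 ≤ x)(ht0 : 0 ≤ t) (ht : t < π / 2) :
    t < arccos x ↔ x < cos t := by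
  rcases le_or_gt x 1 with h1 | h1
  · conv_rhs => rw [← cos_arccos (by linarith : -1 ≤ x) h1]
    exact (strictAntiOn_cos.lt_iff_gt ⟨arccos_nonneg x, arccos_le_pi x⟩
      ⟨by linarith, by linarith⟩).symm
  · rw [arccos_of_one_le h1.le]
    have := cos_le_one t
    constructor <;> intro <;> linarith

/-- Away from its two break points, `ρ ↦ min t (arccos (a / ρ))` is differentiable, with
derivative supported in the interval between them. -/
theorem hasDerivAt_min_arccos {a t ρ : ℝ} (ha : 0 < a) (ht0 : 0 ≤ t) (ht : t < π / 2)
    (hρ : 0 < ρ) (h1 : ρ ≠ a) (h2 : ρ ≠ a / cos t) :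
    HasDerivAt (fun r => min t (arccos (a / r)))
      (if a < ρ ∧ ρ < a / cos t then a / ρ * (√(ρ ^ 2 - a ^ 2))⁻¹ else 0) ρ := by
  have hct : 0 < cos t := cos_pos_of_mem_Ioo ⟨by linarith, ht⟩
  have key : ∀ r, 0 < r → (t < arccos (a / r) ↔ a / cos t < r) := fun r hr => by
    rw [lt_arccos_iff_cos_gt (by positivity) ht0 ht, div_lt_iff₀ hr, div_lt_iff₀ hct, mul_comm]
  rcases lt_or_gt_of_ne h1 with h1 | h1
  · rw [if_neg (fun h => absurd h.1 h1.not_gt)]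
    refine (hasDerivAt_const ρ (0 : ℝ)).congr_of_eventuallyEq ?_
    filter_upwards [Iio_mem_nhds h1, Ioi_mem_nhds hρ] with r hr hr0
    rw [arccos_of_one_le ((one_le_div hr0).2 (le_of_lt hr)), min_eq_right ht0]
  · rcases lt_or_gt_of_ne h2 with h2 | h2
    · rw [if_pos ⟨h1, h2⟩]
      have hlt : a / ρ < 1 := (div_lt_one hρ).2 h1
      have hder : HasDerivAt (fun r => arccos (a / r)) _ ρ :=
        (hasDerivAt_arccos (x := a / ρ) (by have : 0 < a / ρ := by positivity
                                            linarith) hlt.ne).comp ρ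
          ((hasDerivAt_const ρ a).div (hasDerivAt_id ρ) hρ.ne')
      have hs : √(1 - (a / ρ) ^ 2) = √(ρ ^ 2 - a ^ 2) / ρ := by
        rw [show 1 - (a / ρ) ^ 2 = (ρ ^ 2 - a ^ 2) / ρ ^ 2 by field_simp,
          Real.sqrt_div' _ (by positivity), Real.sqrt_sq hρ.le]
      have hpos : 0 < √(ρ ^ 2 - a ^ 2) := Real.sqrt_pos.2 (by nlinarith)
      refine (hder.congr_deriv ?_).congr_of_eventuallyEq ?_
      · simp only [hs]
        field_simp
        simp
      · filter_upwards [Iio_mem_nhds h2, Ioi_mem_nhds hρ] with r hr hr0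
        exact min_eq_right (not_lt.1 fun h => lt_asymm hr ((key r hr0).1 h))
    · rw [if_neg (fun h => absurd h.2 h2.not_gt)]
      refine (hasDerivAt_const ρ t).congr_of_eventuallyEq ?_
      filter_upwards [Ioi_mem_nhds h2, Ioi_mem_nhds hρ] with r hr hr0
      exact min_eq_left ((key r hr0).2 hr).le

theorem sum_active_eq_zero {ι : Type*} [Fintype ι] (c a t : ι → ℝ)
    (ha : ∀ i, 0 < a i) (ht0 : ∀ i, 0 ≤ t i) (ht : ∀ i, t i < π / 2)
    (h : ∀ ρ, 0 < ρ → ∑ i, c i * min (t i) (arccos (a i / ρ)) = 0) (ρ : ℝ) (hρ : 0 < ρ)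
    (hb : ∀ i, ρ ≠ a i ∧ ρ ≠ a i / cos (t i)) (D : ℝ) :
    ∑ i with a i = D ∧ a i < ρ ∧ ρ < a i / cos (t i), c i = 0 := by
  classical
  set P : Finset ι := Finset.univ.filter fun i => a i < ρ ∧ ρ < a i / cos (t i) with hP
  have hst : ∀ᶠ r in 𝓝 ρ, 0 < r ∧ ∀ i, r ≠ a i ∧ r ≠ a i / cos (t i) ∧
      ((a i < r ∧ r < a i / cos (t i)) ↔ i ∈ P) := by
    refine (eventually_gt_nhds hρ).and (Filter.eventually_all.2 fun i => ?_)
    have e1 : ∀ b, ρ ≠ b → ∀ᶠ r in 𝓝 ρ, r ≠ b ∧ (r < b ↔ ρ < b) := by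
      intro b hb
      rcases lt_or_gt_of_ne hb with hb | hb
      · filter_upwards [Iio_mem_nhds hb] with r hr
        exact ⟨ne_of_lt hr, by simp [hb, Set.mem_Iio.1 hr]⟩
      · filter_upwards [Ioi_mem_nhds hb] with r hr
        exact ⟨ne_of_gt hr, iff_of_false (lt_asymm hr) hb.not_gt⟩
    filter_upwards [e1 _ (hb i).1, e1 _ (hb i).2] with r h1 h2
    refine ⟨h1.1, h2.1, ?_⟩
    have : a i < r ↔ a i < ρ := by
      rw [← not_iff_not, not_lt, not_lt, h1.1.le_iff_lt, (hb i).1.le_iff_lt, h1.2]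
    simp [hP, h2.2, this]
  have hder : ∀ᶠ r in 𝓝 ρ, ∑ i ∈ P, c i * (a i * (√(r ^ 2 - a i ^ 2))⁻¹) = 0 := by
    filter_upwards [hst] with r ⟨hr, hri⟩
    have hd : HasDerivAt (fun r => ∑ i, c i * min (t i) (arccos (a i / r)))
        (∑ i, c i * (if a i < r ∧ r < a i / cos (t i)
          then a i / r * (√(r ^ 2 - a i ^ 2))⁻¹ else 0)) r := by
      refine HasDerivAt.fun_sum fun i _ => ?_
      exact (hasDerivAt_min_arccos (ha i) (ht0 i) (ht i) hr (hri i).1 (hri i).2.1).const_mul _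
    have hd0 : HasDerivAt (fun r => ∑ i, c i * min (t i) (arccos (a i / r))) 0 r := by
      refine (hasDerivAt_const r (0 : ℝ)).congr_of_eventuallyEq ?_
      filter_upwards [Ioi_mem_nhds hr] with q hq using h q hq
    have h0 := hd.unique hd0
    simp only [(hri _).2.2] at h0
    simp only [mul_ite, mul_zero, Finset.sum_ite_mem, Finset.univ_inter] at h0
    have h1 : r * ∑ i ∈ P, c i * (a i / r * (√(r ^ 2 - a i ^ 2))⁻¹) = 0 := by rw [h0, mul_zero]
    rw [Finset.mul_sum] at h1
    rw [← h1]
    refine Finset.sum_congr rfl fun i _ => ?_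
    field_simp
  have hgerm : ∀ᶠ r in 𝓝 ρ, ∑ d ∈ P.image a,
      (∑ i ∈ P with a i = d, c i * a i) * (√(r ^ 2 - d ^ 2))⁻¹ = 0 := by
    filter_upwards [hder] with r hr
    rw [← hr, ← Finset.sum_fiberwise_of_maps_to (t := P.image a) (g := a)
      (fun i hi => Finset.mem_image_of_mem a hi)]
    refine Finset.sum_congr rfl fun d _ => ?_
    rw [Finset.sum_mul]
    refine Finset.sum_congr rfl fun i hi => ?_
    rw [(Finset.mem_filter.1 hi).2, mul_assoc]
  have hall := eq_zero_of_sum_inv_sqrt_eq_zero (P.image a)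
    (fun d => ∑ i ∈ P with a i = d, c i * a i) ρ (by
      intro d hd
      obtain ⟨i, hi, rfl⟩ := Finset.mem_image.1 hd
      exact ⟨ha i, (Finset.mem_filter.1 hi).2.1⟩) hgerm
  have hset : (Finset.univ.filter fun i => a i = D ∧ a i < ρ ∧ ρ < a i / cos (t i))
      = P.filter fun i => a i = D := by
    ext i; simp [hP, and_comm]
  rw [hset]
  by_cases hD : D ∈ P.image a
  · have h0 := hall D hD
    have h1 : ∑ i ∈ P with a i = D, c i * a i = (∑ i ∈ P with a i = D, c i) * D := by
      rw [Finset.sum_mul]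
      exact Finset.sum_congr rfl fun i hi => by rw [(Finset.mem_filter.1 hi).2]
    obtain ⟨i, -, rfl⟩ := Finset.mem_image.1 hD
    simp only [h1] at h0
    exact (mul_eq_zero.1 h0).resolve_right (ha i).ne'
  · refine Finset.sum_eq_zero fun i hi => absurd ?_ hD
    obtain ⟨h1, h2⟩ := Finset.mem_filter.1 hi
    exact h2 ▸ Finset.mem_image_of_mem a h1

/-- The functions `ρ ↦ min t (arccos (a / ρ))`, for `a > 0` and `0 < t < π / 2`, are linearly
independent. -/
theorem sum_eq_zero_of_sum_min_arccos_eq_zero {ι : Type*} [Fintype ι] (c a t : ι → ℝ)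
    (ha : ∀ i, 0 < a i) (ht0 : ∀ i, 0 ≤ t i) (ht : ∀ i, t i < π / 2)
    (h : ∀ ρ, 0 < ρ → ∑ i, c i * min (t i) (arccos (a i / ρ)) = 0) {D T : ℝ}
    (hT0 : 0 < T) :
    ∑ i with a i = D ∧ t i = T, c i = 0 := by
  classical
  by_cases hDT : 0 < D ∧ T < π / 2
  swap
  · refine Finset.sum_eq_zero fun i hi => absurd ?_ hDT
    obtain ⟨-, rfl, rfl⟩ := Finset.mem_filter.1 hi
    exact ⟨ha i, ht i⟩
  obtain ⟨hD, hT⟩ := hDT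
  have hcT : 0 < cos T := cos_pos_of_mem_Ioo ⟨by linarith, hT⟩
  set R := D / cos T with hR
  have hDR : D < R := by
    have := (div_lt_div_cos_iff hD le_rfl (by linarith [hT0]) hT0.le hT).2 hT0
    simpa using this
  have hRpos : 0 < R := hD.trans hDR
  have hlt : ∀ b, ∀ᶠ r in 𝓝[<] R, r ≠ b ∧ (r < b ↔ R ≤ b) := by
    intro b
    rcases le_or_gt R b with hb | hb
    · filter_upwards [self_mem_nhdsWithin] with r hr
      have hr' : r < b := lt_of_lt_of_le hr hb
      exact ⟨hr'.ne, by simp [hr', hb]⟩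
    · filter_upwards [nhdsWithin_le_nhds (Ioi_mem_nhds hb)] with r hr
      exact ⟨ne_of_gt hr, iff_of_false (lt_asymm hr) hb.not_ge⟩
  have hgt : ∀ b, ∀ᶠ r in 𝓝[>] R, r ≠ b ∧ (r < b ↔ R < b) := by
    intro b
    rcases lt_or_ge R b with hb | hb
    · filter_upwards [nhdsWithin_le_nhds (Iio_mem_nhds hb)] with r hr
      exact ⟨ne_of_lt hr, by simp [hb, Set.mem_Iio.1 hr]⟩
    · filter_upwards [self_mem_nhdsWithin] with r hr
      have hr' : b < r := lt_of_le_of_lt hb hr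
      exact ⟨hr'.ne', iff_of_false hr'.not_gt hb.not_gt⟩
  obtain ⟨r₁, hr₁, hr₁D, hr₁R⟩ := ((eventually_all.2 fun i =>
    (hlt (a i)).and (hlt (a i / cos (t i)))).and
      (((eventually_gt_nhds hDR).filter_mono nhdsWithin_le_nhds).and
        (eventually_mem_nhdsWithin (s := Set.Iio R)))).exists
  obtain ⟨r₂, hr₂, hr₂R⟩ := ((eventually_all.2 fun i =>
    (hgt (a i)).and (hgt (a i / cos (t i)))).and
      (eventually_mem_nhdsWithin (s := Set.Ioi R))).exists
  have hr₁D' : D < r₁ := hr₁D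
  have hr₂R' : R < r₂ := hr₂R
  have s₁ := sum_active_eq_zero c a t ha ht0 ht h r₁ (hD.trans hr₁D)
    (fun i => ⟨(hr₁ i).1.1, (hr₁ i).2.1⟩) D
  have s₂ := sum_active_eq_zero c a t ha ht0 ht h r₂ (hRpos.trans hr₂R)
    (fun i => ⟨(hr₂ i).1.1, (hr₂ i).2.1⟩) D
  have f₁ : (Finset.univ.filter fun i => a i = D ∧ a i < r₁ ∧ r₁ < a i / cos (t i))
      = Finset.univ.filter fun i => a i = D ∧ T ≤ t i := by
    refine Finset.filter_congr fun i _ => and_congr_right fun hi => ?_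
    rw [(hr₁ i).2.2, hi, ← not_lt, hR, div_lt_div_cos_iff hD (ht0 i) (ht i) hT0.le hT, not_lt]
    simp [hr₁D']
  have f₂ : (Finset.univ.filter fun i => a i = D ∧ a i < r₂ ∧ r₂ < a i / cos (t i))
      = Finset.univ.filter fun i => a i = D ∧ T < t i := by
    refine Finset.filter_congr fun i _ => and_congr_right fun hi => ?_
    rw [(hr₂ i).2.2, hi, hR, div_lt_div_cos_iff hD hT0.le hT (ht0 i) (ht i)]
    simp [hDR.trans hr₂R']
  rw [f₁] at s₁
  rw [f₂] at s₂
  have hsplit : (Finset.univ.filter fun i => a i = D ∧ T ≤ t i)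
      = (Finset.univ.filter fun i => a i = D ∧ t i = T) ∪
        Finset.univ.filter fun i => a i = D ∧ T < t i := by
    ext i
    simp only [Finset.mem_filter, Finset.mem_univ, true_and, Finset.mem_union,
      le_iff_eq_or_lt (a := T), eq_comm (a := T)]
    tauto
  rw [hsplit, Finset.sum_union, s₂, add_zero] at s₁
  · exact s₁
  · refine Finset.disjoint_filter.2 fun i _ h1 h2 => ?_
    exact h2.2.ne' h1.2

theorem sum_sign_filter_abs {ι : Type*} [Fintype ι] (a s : ι → ℝ) (D : ℝ) {T : ℝ} (hT : 0 < T) :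
    (∑ i, if a i = D ∧ |s i| = T then Real.sign (s i) else 0) =
      ((Finset.univ.filter fun i => a i = D ∧ s i = T).card : ℝ) -
        (Finset.univ.filter fun i => a i = D ∧ s i = -T).card := by
  rw [Finset.card_filter, Finset.card_filter]
  push_cast
  rw [← Finset.sum_sub_distrib]
  refine Finset.sum_congr rfl fun i _ => ?_
  by_cases hD : a i = D
  · simp only [hD, true_and]
    rcases eq_or_ne (s i) T with h | h
    · rw [h, abs_of_pos hT, Real.sign_of_pos hT, if_pos rfl, if_neg (by linarith)]
      norm_num
    · rcases eq_or_ne (s i) (-T) with h' | h'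
      · rw [h', abs_neg, abs_of_pos hT, Real.sign_of_neg (by linarith), if_pos rfl,
          if_neg (by linarith)]
        norm_num
      · rw [if_neg h, if_neg h', if_neg]
        · norm_num
        · intro hs
          rcases (abs_eq hT.le).1 hs with hs | hs
          · exact h hs
          · exact h' hs
  · simp [hD]

theorem card_filter_eq_or_card_filter_neg_eq_zero {ι : Type*} [Fintype ι] (a s : ι → ℝ)
    (hs : ∀ i j, i ≠ j → 0 < s i + s j) (D : ℝ) {S : ℝ} (hS : S ≠ 0) :
    (Finset.univ.filter fun i => a i = D ∧ s i = S).card = 0 ∨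
      (Finset.univ.filter fun i => a i = D ∧ s i = -S).card = 0 := by
  by_contra! h
  obtain ⟨i, hi⟩ := Finset.card_ne_zero.1 h.1
  obtain ⟨j, hj⟩ := Finset.card_ne_zero.1 h.2
  simp only [Finset.mem_filter, Finset.mem_univ, true_and] at hi hj
  have hij : i ≠ j := by
    rintro rfl
    apply hS
    linarith [hi.2, hj.2]
  linarith [hs i j hij, hi.2, hj.2]

theorem card_filter_zero_le_one {ι : Type*} [Fintype ι] (a s : ι → ℝ)
    (hs : ∀ i j, i ≠ j → 0 < s i + s j) (D : ℝ) :
    (Finset.univ.filter fun i => a i = D ∧ s i = 0).card ≤ 1 := by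
  refine Finset.card_le_one.2 fun i hi j hj => ?_
  simp only [Finset.mem_filter, Finset.mem_univ, true_and] at hi hj
  by_contra hij
  linarith [hs i j hij, hi.2, hj.2]

/-- A finite family of pairs `(aᵢ, sᵢ)` with `aᵢ > 0` and `|sᵢ| < π / 2` is determined, as a
multiset, by the function `ρ ↦ ∑ᵢ sign sᵢ * min |sᵢ| (arccos (aᵢ / ρ))`, provided that at most
one `sᵢ` is nonpositive in the strong sense that `sᵢ + sⱼ > 0` for `i ≠ j`, and that every value
of `a` is attained an even number of times. -/
theorem map_eq_of_sum_sign_mul_min_arccos_eq {ι : Type*} [Fintype ι] (a s a' s' : ι → ℝ)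
    (ha : ∀ i, 0 < a i) (ha' : ∀ i, 0 < a' i)
    (hs : ∀ i, |s i| < π / 2) (hs' : ∀ i, |s' i| < π / 2)
    (hpos : ∀ i j, i ≠ j → 0 < s i + s j) (hpos' : ∀ i j, i ≠ j → 0 < s' i + s' j)
    (heven : ∀ D, Even (Finset.univ.filter fun i => a i = D).card)
    (heven' : ∀ D, Even (Finset.univ.filter fun i => a' i = D).card)
    (h : ∀ ρ, 0 < ρ → ∑ i, Real.sign (s i) * min |s i| (arccos (a i / ρ)) =
      ∑ i, Real.sign (s' i) * min |s' i| (arccos (a' i / ρ))) :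
    (Finset.univ.val.map fun i => (a i, s i)) = Finset.univ.val.map fun i => (a' i, s' i) := by
  classical
  have hdiff : ∀ D T, 0 < T →
      ((Finset.univ.filter fun i => a i = D ∧ s i = T).card : ℝ) -
        (Finset.univ.filter fun i => a i = D ∧ s i = -T).card =
      ((Finset.univ.filter fun i => a' i = D ∧ s' i = T).card : ℝ) -
        (Finset.univ.filter fun i => a' i = D ∧ s' i = -T).card := by
    intro D T hT
    have key := sum_eq_zero_of_sum_min_arccos_eq_zero (ι := ι ⊕ ι)
      (Sum.elim (fun i => Real.sign (s i)) fun i => -Real.sign (s' i)) (Sum.elim a a')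
      (Sum.elim (fun i => |s i|) fun i => |s' i|)
      (by rintro (i | i); exacts [ha i, ha' i])
      (by rintro (i | i); exacts [abs_nonneg _, abs_nonneg _])
      (by rintro (i | i); exacts [hs i, hs' i])
      (by
        intro ρ hρ
        simp only [Fintype.sum_sum_type, Sum.elim_inl, Sum.elim_inr, neg_mul,
          Finset.sum_neg_distrib, h ρ hρ]
        ring) (D := D) hT
    rw [Finset.sum_filter, Fintype.sum_sum_type] at key
    replace key : (∑ i, if a i = D ∧ |s i| = T then Real.sign (s i) else 0) +
      ∑ i, (if a' i = D ∧ |s' i| = T then -Real.sign (s' i) else 0) = 0 := key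
    have hneg : (∑ i, if a' i = D ∧ |s' i| = T then -Real.sign (s' i) else 0) =
        -∑ i, if a' i = D ∧ |s' i| = T then Real.sign (s' i) else 0 := by
      rw [← Finset.sum_neg_distrib]
      refine Finset.sum_congr rfl fun i _ => ?_
      split_ifs <;> simp
    rw [← sum_sign_filter_abs a s D hT, ← sum_sign_filter_abs a' s' D hT]
    linarith
  have hpm : ∀ D T, 0 < T →
      (Finset.univ.filter fun i => a i = D ∧ s i = T).card =
        (Finset.univ.filter fun i => a' i = D ∧ s' i = T).card ∧
      (Finset.univ.filter fun i => a i = D ∧ s i = -T).card =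
        (Finset.univ.filter fun i => a' i = D ∧ s' i = -T).card := by
    intro D T hT
    have e := hdiff D T hT
    have e1 := card_filter_eq_or_card_filter_neg_eq_zero a s hpos D hT.ne'
    have e2 := card_filter_eq_or_card_filter_neg_eq_zero a' s' hpos' D hT.ne'
    have e' : ((Finset.univ.filter fun i => a i = D ∧ s i = T).card : ℤ) -
        (Finset.univ.filter fun i => a i = D ∧ s i = -T).card =
      ((Finset.univ.filter fun i => a' i = D ∧ s' i = T).card : ℤ) -
        (Finset.univ.filter fun i => a' i = D ∧ s' i = -T).card := by exact_mod_cast e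
    omega
  have hne : ∀ D S, S ≠ 0 → (Finset.univ.filter fun i => a i = D ∧ s i = S).card =
        (Finset.univ.filter fun i => a' i = D ∧ s' i = S).card := by
    intro D S hS
    rcases lt_or_gt_of_ne hS with h0 | h0
    · simpa using (hpm D (-S) (by linarith)).2
    · exact (hpm D S h0).1
  have hnz : ∀ D, (Finset.univ.filter fun i => a i = D ∧ s i ≠ 0).card =
        (Finset.univ.filter fun i => a' i = D ∧ s' i ≠ 0).card := by
    intro D
    set U := (Finset.univ.image s ∪ Finset.univ.image s').erase 0 with hU
    rw [Finset.card_eq_sum_card_fiberwise (f := s) (t := U),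
      Finset.card_eq_sum_card_fiberwise (f := s') (t := U)]
    · refine Finset.sum_congr rfl fun S hS => ?_
      have hS0 : S ≠ 0 := (Finset.mem_erase.1 hS).1
      have := hne D S hS0
      convert this using 2
      · ext i; simp only [Finset.mem_filter, Finset.mem_univ, true_and]
        constructor
        · rintro ⟨⟨h1, -⟩, h2⟩; exact ⟨h1, h2⟩
        · rintro ⟨h1, h2⟩; exact ⟨⟨h1, h2 ▸ hS0⟩, h2⟩
      · ext i; simp only [Finset.mem_filter, Finset.mem_univ, true_and]
        constructor
        · rintro ⟨⟨h1, -⟩, h2⟩; exact ⟨h1, h2⟩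
        · rintro ⟨h1, h2⟩; exact ⟨⟨h1, h2 ▸ hS0⟩, h2⟩
    · intro i hi
      simp only [Finset.coe_filter, Finset.mem_univ, true_and, Set.mem_ofPred_eq] at hi
      simp [hU, hi.2]
    · intro i hi
      simp only [Finset.coe_filter, Finset.mem_univ, true_and, Set.mem_ofPred_eq] at hi
      simp [hU, hi.2]
  have hz : ∀ D, (Finset.univ.filter fun i => a i = D ∧ s i = 0).card =
        (Finset.univ.filter fun i => a' i = D ∧ s' i = 0).card := by
    intro D
    have h1 := card_filter_zero_le_one a s hpos D
    have h2 := card_filter_zero_le_one a' s' hpos' D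
    have h3 := heven D
    have h4 := heven' D
    rw [← Finset.card_filter_add_card_filter_not (fun i => s i = 0), Finset.filter_filter,
      Finset.filter_filter, hnz D] at h3
    rw [← Finset.card_filter_add_card_filter_not (fun i => s' i = 0), Finset.filter_filter,
      Finset.filter_filter] at h4
    rw [Nat.even_iff] at h3 h4
    simp only [ne_eq] at h3
    omega
  ext ⟨D, S⟩
  rw [Multiset.count_map, Multiset.count_map, ← Finset.filter_val, ← Finset.filter_val,
    Finset.card_val, Finset.card_val]
  have hall : (Finset.univ.filter fun i => a i = D ∧ s i = S).card =
        (Finset.univ.filter fun i => a' i = D ∧ s' i = S).card := by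
    rcases eq_or_ne S 0 with rfl | hS
    · exact hz D
    · exact hne D S hS
  convert hall using 4 <;> rw [Prod.mk.injEq, eq_comm, eq_comm (a := S)]

/-- The pairs (side, vertex on that side) of a triangle, a side having the index of the opposite
vertex. -/
abbrev Slot : Type := {p : Fin 3 × Fin 3 // p.1 ≠ p.2}

theorem sum_slot {M : Type*} [AddCommMonoid M] (f : Fin 3 → Fin 3 → M) :
    ∑ p : Slot, f p.1.1 p.1.2 =
      (f 0 1 + f 0 2) + (f 1 0 + f 1 2) + (f 2 0 + f 2 1) := by
  rw [← Finset.sum_subtype (Finset.univ.filter fun p : Fin 3 × Fin 3 => p.1 ≠ p.2) (by simp)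
    fun p => f p.1 p.2, Finset.sum_filter, Fintype.sum_prod_type]
  simp [Fin.sum_univ_three]

/-- The permutation of the slots induced by a permutation of the vertices. -/
def slotPerm (σ : Equiv.Perm (Fin 3)) : Slot ≃ Slot :=
  (Equiv.prodCongr σ σ).subtypeEquiv fun _ => σ.injective.ne_iff.symm

theorem sum_slot_comp {M : Type*} [AddCommMonoid M] (f : Fin 3 → Fin 3 → M)
    (σ : Equiv.Perm (Fin 3)) :
    ∑ p : Slot, f (σ p.1.1) (σ p.1.2) = ∑ p : Slot, f p.1.1 p.1.2 :=
  (slotPerm σ).sum_comp fun p : Slot => f p.1.1 p.1.2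

/-- Metric data of a triangle around the origin: `d i` is the distance from the origin to the
line carrying the `i`-th side, `R j` the distance to the `j`-th vertex, and `s i j` the signed
angle at the origin between the foot of the perpendicular to the `i`-th side and the `j`-th
vertex. -/
structure IsProfile (d R : Fin 3 → ℝ) (s : Fin 3 → Fin 3 → ℝ) : Prop where
  pos : ∀ i, 0 < d i
  abs_lt : ∀ i j, i ≠ j → |s i j| < π / 2
  mul_cos : ∀ i j, i ≠ j → R j * cos (s i j) = d i
  sum_eq : ∑ p : Slot, s p.1.1 p.1.2 = 2 * π

/-- The angle which the `i`-th side subtends at the origin. -/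
def width (s : Fin 3 → Fin 3 → ℝ) (i : Fin 3) : ℝ := ∑ j ∈ Finset.univ.erase i, s i j

theorem width_comp (s : Fin 3 → Fin 3 → ℝ) (σ : Equiv.Perm (Fin 3)) (i : Fin 3) :
    width (fun i j => s (σ i) (σ j)) i = width s (σ i) := by
  unfold width
  refine Finset.sum_equiv σ (fun j => ?_) fun j _ => rfl
  simp

theorem width_zero (s : Fin 3 → Fin 3 → ℝ) : width s 0 = s 0 1 + s 0 2 := by
  rw [width, show (Finset.univ.erase 0 : Finset (Fin 3)) = {1, 2} by decide,
    Finset.sum_pair (by decide)]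

theorem width_one (s : Fin 3 → Fin 3 → ℝ) : width s 1 = s 1 0 + s 1 2 := by
  rw [width, show (Finset.univ.erase 1 : Finset (Fin 3)) = {0, 2} by decide,
    Finset.sum_pair (by decide)]

theorem width_two (s : Fin 3 → Fin 3 → ℝ) : width s 2 = s 2 0 + s 2 1 := by
  rw [width, show (Finset.univ.erase 2 : Finset (Fin 3)) = {0, 1} by decide,
    Finset.sum_pair (by decide)]

namespace IsProfile

variable {d R d' R' : Fin 3 → ℝ} {s s' : Fin 3 → Fin 3 → ℝ}

theorem comp (h : IsProfile d R s) (σ : Equiv.Perm (Fin 3)) :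
    IsProfile (d ∘ σ) (R ∘ σ) (fun i j => s (σ i) (σ j)) where
  pos i := h.pos _
  abs_lt i j hij := h.abs_lt _ _ (σ.injective.ne hij)
  mul_cos i j hij := h.mul_cos _ _ (σ.injective.ne hij)
  sum_eq := by rw [← h.sum_eq]; exact sum_slot_comp s σ

theorem cos_pos (h : IsProfile d R s) {i j : Fin 3} (hij : i ≠ j) : 0 < cos (s i j) :=
  cos_pos_of_mem_Ioo (_root_.abs_lt.1 (h.abs_lt i j hij))

theorem R_eq (h : IsProfile d R s) {i j : Fin 3} (hij : i ≠ j) : R j = d i / cos (s i j) := by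
  rw [← h.mul_cos i j hij, mul_div_cancel_right₀ _ (h.cos_pos hij).ne']

theorem R_pos (h : IsProfile d R s) (j : Fin 3) : 0 < R j := by
  obtain ⟨i, hi⟩ : ∃ i : Fin 3, i ≠ j := exists_ne j
  rw [h.R_eq hi]
  exact div_pos (h.pos i) (h.cos_pos hi)

theorem add_pos (h : IsProfile d R s) (p q : Slot) (hpq : p ≠ q) :
    0 < s p.1.1 p.1.2 + s q.1.1 q.1.2 := by
  have hlt : ∀ r : Slot, 0 < π / 2 - s r.1.1 r.1.2 := fun r => by
    have := (_root_.abs_lt.1 (h.abs_lt _ _ r.2)).2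
    linarith
  have hcard : Fintype.card Slot = 6 := by decide
  obtain ⟨r, hr⟩ : ∃ r : Slot, r ∉ ({p, q} : Finset Slot) := by
    by_contra! hall
    have : Fintype.card Slot ≤ ({p, q} : Finset Slot).card :=
      Finset.card_le_card fun r _ => hall r
    have := Finset.card_le_two (a := p) (b := q)
    omega
  have key : ∑ r ∈ ({p, q} : Finset Slot), (π / 2 - s r.1.1 r.1.2) <
      ∑ r : Slot, (π / 2 - s r.1.1 r.1.2) :=
    Finset.sum_lt_sum_of_subset (Finset.subset_univ _) (Finset.mem_univ r) hr (hlt r)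
      fun _ _ _ => (hlt _).le
  rw [Finset.sum_pair hpq, Finset.sum_sub_distrib, h.sum_eq, Finset.sum_const, Finset.card_univ,
    hcard] at key
  norm_num at key
  linarith

theorem add_pos' (h : IsProfile d R s) {i j k l : Fin 3} (hij : i ≠ j) (hkl : k ≠ l)
    (hne : (i, j) ≠ (k, l)) : 0 < s i j + s k l :=
  h.add_pos ⟨(i, j), hij⟩ ⟨(k, l), hkl⟩ fun he => hne (congrArg Subtype.val he)

end IsProfile

theorem eq_or_eq_neg_of_cos_eq {x y : ℝ} (hx : |x| < π / 2) (hy : |y| < π / 2)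
    (h : cos x = cos y) : x = y ∨ x = -y := by
  rw [← abs_eq_abs]
  rw [← cos_abs x, ← cos_abs y] at h
  have := pi_pos
  exact injOn_cos ⟨abs_nonneg x, by linarith⟩ ⟨abs_nonneg y, by linarith⟩ h

theorem eq_of_cos_eq_of_add_pos {x y : ℝ} (hx : |x| < π / 2) (hy : |y| < π / 2)
    (h : cos x = cos y) (hxy : 0 < x + y) : x = y := by
  rcases eq_or_eq_neg_of_cos_eq hx hy h with h | h
  · exact h
  · linarith

theorem exists_perm_of_sum_eq {ι : Type*} [Fintype ι] (x y : ι → ℝ)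
    (h : ∀ g : ℝ → ℝ, ∑ i, g (x i) = ∑ i, g (y i)) : ∃ σ : Equiv.Perm ι, ∀ i, y (σ i) = x i := by
  classical
  have hc : ∀ c, Nonempty (x ⁻¹' {c} ≃ y ⁻¹' {c}) := by
    intro c
    refine ⟨Fintype.equivOfCardEq ?_⟩
    have h1 := h fun t => if t = c then 1 else 0
    rw [← Nat.cast_inj (R := ℝ)]
    simp only [Finset.sum_boole] at h1
    have e : ∀ z : ι → ℝ, Fintype.card (z ⁻¹' {c}) = (Finset.univ.filter fun i => z i = c).card :=
      fun z => Fintype.card_of_subtype _ fun i => by simp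
    rw [e x, e y, h1]
  exact ⟨Equiv.ofPreimageEquiv fun c => (hc c).some, fun i => Equiv.ofPreimageEquiv_map _ i⟩

namespace IsProfile

variable {d R R' : Fin 3 → ℝ} {s s' : Fin 3 → Fin 3 → ℝ}

theorem eq_of_vertex (h : IsProfile d R s) {i k j : Fin 3} (hij : i ≠ j) (hkj : k ≠ j)
    (hd : d i = d k) : s i j = s k j := by
  rcases eq_or_ne i k with rfl | hik
  · rfl
  refine eq_of_cos_eq_of_add_pos (h.abs_lt _ _ hij) (h.abs_lt _ _ hkj) ?_
    (h.add_pos' hij hkj (by simp [hik]))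
  have := h.mul_cos i j hij
  rw [hd, ← h.mul_cos k j hkj] at this
  exact mul_left_cancel₀ (h.R_pos j).ne' this

theorem match_of_distinct (h : IsProfile d R s) (h' : IsProfile d R' s')
    (hM : ∀ f : ℝ → ℝ → ℝ, ∑ p : Slot, f (d p.1.1) (s p.1.1 p.1.2) =
      ∑ p : Slot, f (d p.1.1) (s' p.1.1 p.1.2))
    (h01 : d 0 ≠ d 1) (h02 : d 0 ≠ d 2) (h12 : d 1 ≠ d 2) :
    ∀ i, R' i = R i ∧ width s' i = width s i := by
  have e : ∀ g : ℝ → ℝ, g (s 0 1) + g (s 0 2) = g (s' 0 1) + g (s' 0 2) ∧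
      g (s 1 0) + g (s 1 2) = g (s' 1 0) + g (s' 1 2) ∧
      g (s 2 0) + g (s 2 1) = g (s' 2 0) + g (s' 2 1) := by
    intro g
    have hM' : ∀ D, _ := fun D => by
      have m := hM fun x y => if x = D then g y else 0
      rw [sum_slot fun i j => if d i = D then g (s i j) else 0,
        sum_slot fun i j => if d i = D then g (s' i j) else 0] at m
      exact m
    have m0 := hM' (d 0)
    have m1 := hM' (d 1)
    have m2 := hM' (d 2)
    simp only [h01, h02, h12, h01.symm, h02.symm, h12.symm, if_true, if_false, add_zero,
      zero_add] at m0 m1 m2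
    exact ⟨m0, m1, m2⟩
  have r := e fun x => (cos x)⁻¹
  have w := e id
  have hr : ∀ {i j : Fin 3}, i ≠ j →
      (cos (s i j))⁻¹ = R j / d i ∧ (cos (s' i j))⁻¹ = R' j / d i := by
    intro i j hij
    have := h.pos i
    have := h.cos_pos hij
    have := h'.cos_pos hij
    rw [h.R_eq hij, h'.R_eq hij]
    constructor <;> field_simp
  simp only [(hr (show (0 : Fin 3) ≠ 1 by decide)).1, (hr (show (0 : Fin 3) ≠ 1 by decide)).2,
    (hr (show (0 : Fin 3) ≠ 2 by decide)).1, (hr (show (0 : Fin 3) ≠ 2 by decide)).2,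
    (hr (show (1 : Fin 3) ≠ 0 by decide)).1, (hr (show (1 : Fin 3) ≠ 0 by decide)).2,
    (hr (show (1 : Fin 3) ≠ 2 by decide)).1, (hr (show (1 : Fin 3) ≠ 2 by decide)).2,
    (hr (show (2 : Fin 3) ≠ 0 by decide)).1, (hr (show (2 : Fin 3) ≠ 0 by decide)).2,
    (hr (show (2 : Fin 3) ≠ 1 by decide)).1, (hr (show (2 : Fin 3) ≠ 1 by decide)).2,
    ← add_div] at r
  obtain ⟨r0, r1, r2⟩ := r
  rw [div_left_inj' (h.pos _).ne'] at r0 r1 r2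
  obtain ⟨w0, w1, w2⟩ := w
  simp only [id] at w0 w1 w2
  intro i
  fin_cases i
  · exact ⟨by simp; linarith, by simp [width_zero, w0]⟩
  · exact ⟨by simp; linarith, by simp [width_one, w1]⟩
  · exact ⟨by simp; linarith, by simp [width_two, w2]⟩

theorem match_of_all_eq (h : IsProfile d R s) (h' : IsProfile d R' s')
    (hM : ∀ f : ℝ → ℝ → ℝ, ∑ p : Slot, f (d p.1.1) (s p.1.1 p.1.2) =
      ∑ p : Slot, f (d p.1.1) (s' p.1.1 p.1.2))
    (h01 : d 0 = d 1) (h02 : d 0 = d 2) :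
    ∃ σ : Equiv.Perm (Fin 3), ∀ i, R' (σ i) = R i ∧ width s' (σ i) = width s i := by
  have hd : ∀ i k, d i = d k := by
    intro i k
    fin_cases i <;> fin_cases k <;> simp [← h01, ← h02]
  have hne : ∀ j : Fin 3, j + 1 ≠ j := by decide
  have hc : ∀ i j, i ≠ j → s i j = s (j + 1) j :=
    fun i j hij => h.eq_of_vertex hij (hne j) (hd _ _)
  have hc' : ∀ i j, i ≠ j → s' i j = s' (j + 1) j :=
    fun i j hij => h'.eq_of_vertex hij (hne j) (hd _ _)
  obtain ⟨σ, hσ⟩ := exists_perm_of_sum_eq (fun j => s (j + 1) j) (fun j => s' (j + 1) j) (by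
    intro g
    have hg := hM fun _ y => g y
    have e1 : ∀ p : Slot, s p.1.1 p.1.2 = s (p.1.2 + 1) p.1.2 := fun p => hc _ _ p.2
    have e2 : ∀ p : Slot, s' p.1.1 p.1.2 = s' (p.1.2 + 1) p.1.2 := fun p => hc' _ _ p.2
    simp only [e1, e2] at hg
    rw [sum_slot fun _ j => g (s (j + 1) j), sum_slot fun _ j => g (s' (j + 1) j)] at hg
    rw [Fin.sum_univ_three, Fin.sum_univ_three]
    linarith)
  refine ⟨σ, fun i => ⟨?_, ?_⟩⟩
  · rw [h.R_eq (hne i), h'.R_eq (hne (σ i)), hσ i, hd]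
  · rw [← width_comp]
    refine Finset.sum_congr rfl fun j hj => ?_
    have hij : i ≠ j := (Finset.ne_of_mem_erase hj).symm
    change s' (σ i) (σ j) = s i j
    rw [hc i j hij, hc' _ _ (σ.injective.ne hij), hσ j]

theorem match_of_pair_of_R_eq (h : IsProfile d R s) (h' : IsProfile d R' s')
    (hM : ∀ f : ℝ → ℝ → ℝ, ∑ p : Slot, f (d p.1.1) (s p.1.1 p.1.2) =
      ∑ p : Slot, f (d p.1.1) (s' p.1.1 p.1.2))
    (h01 : d 0 = d 1) (h02 : d 0 ≠ d 2) (hR0 : R' 0 = R 0) (hR1 : R' 1 = R 1) :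
    ∀ i, R' i = R i ∧ width s' i = width s i := by
  have h12 : d 1 ≠ d 2 := h01 ▸ h02
  have c := h.eq_of_vertex (i := 0) (k := 1) (j := 2) (by decide) (by decide) h01
  have c' := h'.eq_of_vertex (i := 0) (k := 1) (j := 2) (by decide) (by decide) h01
  have e1 : ∀ g : ℝ → ℝ, g (s 2 0) + g (s 2 1) = g (s' 2 0) + g (s' 2 1) := by
    intro g
    have m := hM fun x y => if x = d 2 then g y else 0
    rw [sum_slot fun i j => if d i = d 2 then g (s i j) else 0,
      sum_slot fun i j => if d i = d 2 then g (s' i j) else 0] at m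
    simpa only [h02, h12, if_true, if_false, add_zero, zero_add] using m
  have e2 : ∀ g : ℝ → ℝ, g (s 0 1) + g (s 0 2) + (g (s 1 0) + g (s 1 2)) =
      g (s' 0 1) + g (s' 0 2) + (g (s' 1 0) + g (s' 1 2)) := by
    intro g
    have m := hM fun _ y => g y
    rw [sum_slot fun i j => g (s i j), sum_slot fun i j => g (s' i j)] at m
    linarith [e1 g]
  have cpos : 0 < s 0 2 + s 1 2 := h.add_pos' (by decide) (by decide) (by decide)
  have cpos' : 0 < s' 0 2 + s' 1 2 := h'.add_pos' (by decide) (by decide) (by decide)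
  have abpos : 0 < s 0 1 + s 1 0 := h.add_pos' (by decide) (by decide) (by decide)
  have abpos' : 0 < s' 0 1 + s' 1 0 := h'.add_pos' (by decide) (by decide) (by decide)
  have emin := e2 fun x => min x 0
  rw [min_eq_right (by linarith : 0 ≤ s 0 2), min_eq_right (by linarith : 0 ≤ s 1 2),
    min_eq_right (by linarith : 0 ≤ s' 0 2), min_eq_right (by linarith : 0 ≤ s' 1 2)] at emin
  have hcos : ∀ {i j : Fin 3}, i ≠ j → R' j = R j → s' i j = s i j ∨ s' i j = -s i j := by
    intro i j hij hR
    refine eq_or_eq_neg_of_cos_eq (h'.abs_lt _ _ hij) (h.abs_lt _ _ hij) ?_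
    have := h'.mul_cos i j hij
    rw [hR, ← h.mul_cos i j hij] at this
    exact mul_left_cancel₀ (h.R_pos j).ne' this
  have hab : s' 0 1 = s 0 1 ∧ s' 1 0 = s 1 0 := by
    rcases hcos (show (0 : Fin 3) ≠ 1 by decide) hR1 with ha | ha <;>
    rcases hcos (show (1 : Fin 3) ≠ 0 by decide) hR0 with hb | hb
    · exact ⟨ha, hb⟩
    · refine ⟨ha, ?_⟩
      rw [ha, hb] at emin
      rcases min_cases (s 1 0) 0 with h1 | h1 <;> rcases min_cases (-s 1 0) 0 with h2 | h2 <;>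
        linarith
    · refine ⟨?_, hb⟩
      rw [ha, hb] at emin
      rcases min_cases (s 0 1) 0 with h1 | h1 <;> rcases min_cases (-s 0 1) 0 with h2 | h2 <;>
        linarith
    · linarith
  have eid := e2 id
  simp only [id] at eid
  have hcc : s' 0 2 = s 0 2 := by linarith [hab.1, hab.2]
  have hR2 : R' 2 = R 2 := by
    rw [h'.R_eq (show (0 : Fin 3) ≠ 2 by decide), h.R_eq (show (0 : Fin 3) ≠ 2 by decide), hcc]
  have w2 := e1 id
  simp only [id] at w2
  intro i
  fin_cases i
  · exact ⟨hR0, by simp [width_zero]; linarith [hab.1]⟩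
  · exact ⟨hR1, by simp [width_one]; linarith [hab.2]⟩
  · exact ⟨hR2, by simp [width_two]; linarith⟩

theorem match_of_pair (h : IsProfile d R s) (h' : IsProfile d R' s')
    (hM : ∀ f : ℝ → ℝ → ℝ, ∑ p : Slot, f (d p.1.1) (s p.1.1 p.1.2) =
      ∑ p : Slot, f (d p.1.1) (s' p.1.1 p.1.2))
    (h01 : d 0 = d 1) (h02 : d 0 ≠ d 2) :
    ∃ σ : Equiv.Perm (Fin 3), ∀ i, R' (σ i) = R i ∧ width s' (σ i) = width s i := by
  have h12 : d 1 ≠ d 2 := h01 ▸ h02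
  have e : ∀ n : ℕ, R 0 ^ n + R 1 ^ n = R' 0 ^ n + R' 1 ^ n := by
    intro n
    have m := hM fun x y => if x = d 2 then (d 2 / cos y) ^ n else 0
    rw [sum_slot fun i j => if d i = d 2 then (d 2 / cos (s i j)) ^ n else 0,
      sum_slot fun i j => if d i = d 2 then (d 2 / cos (s' i j)) ^ n else 0] at m
    simp only [h02, h12, if_true, if_false, add_zero, zero_add] at m
    rwa [← h.R_eq (by decide), ← h.R_eq (by decide), ← h'.R_eq (by decide),
      ← h'.R_eq (by decide)] at m
  have m1 := e 1
  have m2 := e 2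
  simp only [pow_one] at m1
  have hprod : (R' 0 - R 0) * (R' 0 - R 1) = 0 := by
    have hx : R' 1 = R 0 + R 1 - R' 0 := by linarith
    rw [hx] at m2
    linear_combination -m2 / 2
  rcases mul_eq_zero.1 hprod with h0 | h0
  · exact ⟨1, match_of_pair_of_R_eq h h' hM h01 h02 (sub_eq_zero.1 h0)
      (show R' 1 = R 1 by linarith)⟩
  · set σ : Equiv.Perm (Fin 3) := Equiv.swap 0 1 with hσ
    have hdσ : d ∘ σ = d := by
      funext i
      fin_cases i <;> simp [hσ, h01, Equiv.swap_apply_of_ne_of_ne]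
    have h'' := h'.comp σ
    rw [hdσ] at h''
    have := match_of_pair_of_R_eq h h'' (by
      intro f
      rw [hM f, ← sum_slot_comp (fun i j => f (d i) (s' i j)) σ]
      refine Finset.sum_congr rfl fun p _ => ?_
      rw [show d (σ p.1.1) = d p.1.1 from congrFun hdσ _]) h01 h02
      (by simp [hσ]; linarith) (by simp [hσ]; linarith)
    exact ⟨σ, fun i => ⟨(this i).1, (width_comp s' σ i).symm.trans (this i).2⟩⟩

theorem match_of_pair_comp (h : IsProfile d R s) (h' : IsProfile d R' s')
    (hM : ∀ f : ℝ → ℝ → ℝ, ∑ p : Slot, f (d p.1.1) (s p.1.1 p.1.2) =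
      ∑ p : Slot, f (d p.1.1) (s' p.1.1 p.1.2)) (τ : Equiv.Perm (Fin 3))
    (h01 : d (τ 0) = d (τ 1)) (h02 : d (τ 0) ≠ d (τ 2)) :
    ∃ σ : Equiv.Perm (Fin 3), ∀ i, R' (σ i) = R i ∧ width s' (σ i) = width s i := by
  obtain ⟨σ, hσ⟩ := match_of_pair (h.comp τ) (h'.comp τ) (by
    intro f
    have := hM f
    rwa [← sum_slot_comp (fun i j => f (d i) (s i j)) τ,
      ← sum_slot_comp (fun i j => f (d i) (s' i j)) τ] at this) h01 h02
  refine ⟨(τ.symm.trans σ).trans τ, fun i => ?_⟩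
  have := hσ (τ.symm i)
  simpa [width_comp] using this

/-- Two profiles with the same multiset of pairs `(d i, s i j)` agree up to a permutation of the
vertices. -/
theorem exists_match {d' : Fin 3 → ℝ} (h : IsProfile d R s) (h' : IsProfile d' R' s')
    (hM : ∀ f : ℝ → ℝ → ℝ, ∑ p : Slot, f (d p.1.1) (s p.1.1 p.1.2) =
      ∑ p : Slot, f (d' p.1.1) (s' p.1.1 p.1.2)) :
    ∃ σ : Equiv.Perm (Fin 3), ∀ i, R' (σ i) = R i ∧ width s' (σ i) = width s i := by
  obtain ⟨τ, hτ⟩ := exists_perm_of_sum_eq d d' (by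
    intro g
    have m := hM fun x _ => g x
    rw [sum_slot fun i _ => g (d i), sum_slot fun i _ => g (d' i)] at m
    rw [Fin.sum_univ_three, Fin.sum_univ_three]
    linarith)
  have h'' := h'.comp τ
  rw [show d' ∘ τ = d from funext hτ] at h''
  have hM' : ∀ f : ℝ → ℝ → ℝ, ∑ p : Slot, f (d p.1.1) (s p.1.1 p.1.2) =
      ∑ p : Slot, f (d p.1.1) (s' (τ p.1.1) (τ p.1.2)) := by
    intro f
    rw [hM f, ← sum_slot_comp (fun i j => f (d' i) (s' i j)) τ]
    simp only [hτ]
  obtain ⟨σ, hσ⟩ : ∃ σ : Equiv.Perm (Fin 3), ∀ i, (R' ∘ τ) (σ i) = R i ∧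
      width (fun i j => s' (τ i) (τ j)) (σ i) = width s i := by
    by_cases h01 : d 0 = d 1
    · by_cases h02 : d 0 = d 2
      · exact match_of_all_eq h h'' hM' h01 h02
      · exact match_of_pair h h'' hM' h01 h02
    · by_cases h02 : d 0 = d 2
      · refine match_of_pair_comp h h'' hM' (Equiv.swap 1 2) ?_ ?_
        · simpa [Equiv.swap_apply_of_ne_of_ne] using h02
        · simpa [Equiv.swap_apply_of_ne_of_ne] using h01
      · by_cases h12 : d 1 = d 2
        · refine match_of_pair_comp h h'' hM' (Equiv.swap 0 2) ?_ ?_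
          · simpa [Equiv.swap_apply_of_ne_of_ne] using h12.symm
          · simpa [Equiv.swap_apply_of_ne_of_ne] using Ne.symm h02
        · exact ⟨1, match_of_distinct h h'' hM' h01 h02 h12⟩
  exact ⟨σ.trans τ, fun i => ⟨(hσ i).1, (width_comp s' τ (σ i)).symm.trans (hσ i).2⟩⟩

end IsProfile

theorem intervalIntegrable_indicator_one {A : Set ℝ} (hA : MeasurableSet A) (a b : ℝ) :
    IntervalIntegrable (A.indicator fun _ => (1 : ℝ)) volume a b := by
  rw [intervalIntegrable_iff]
  exact (intervalIntegrable_iff.1 (intervalIntegrable_const (c := (1 : ℝ)))).indicator hA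

theorem measurableSet_mul_cos_le (ρ d : ℝ) : MeasurableSet {u : ℝ | ρ * cos u ≤ d} :=
  measurableSet_le (by fun_prop) (by fun_prop)

theorem integral_indicator_mul_cos_le_of_nonneg {ρ d s : ℝ} (hρ : 0 < ρ) (hd : 0 < d)
    (hs0 : 0 ≤ s) (hs : s < π / 2) :
    ∫ u in (0 : ℝ)..s, {u : ℝ | ρ * cos u ≤ d}.indicator (fun _ => (1 : ℝ)) u =
      s - min s (arccos (d / ρ)) := by
  have hα := arccos_nonneg (d / ρ)
  have hm0 : 0 ≤ min s (arccos (d / ρ)) := le_min hs0 hα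
  have hms : min s (arccos (d / ρ)) ≤ s := min_le_left _ _
  have key : ∀ u, 0 ≤ u → u < π / 2 → (u < arccos (d / ρ) ↔ ¬ ρ * cos u ≤ d) := by
    intro u h0 h1
    rw [lt_arccos_iff_cos_gt (by positivity) h0 h1, div_lt_iff₀ hρ, not_le, mul_comm]
  have hi := intervalIntegrable_indicator_one (measurableSet_mul_cos_le ρ d)
  rw [← intervalIntegral.integral_add_adjacent_intervals (hi 0 (min s (arccos (d / ρ))))
    (hi (min s (arccos (d / ρ))) s)]
  have e1 : ∫ u in (0 : ℝ)..min s (arccos (d / ρ)),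
      {u : ℝ | ρ * cos u ≤ d}.indicator (fun _ => (1 : ℝ)) u = 0 := by
    rw [intervalIntegral.integral_of_le hm0, integral_Ioc_eq_integral_Ioo]
    refine setIntegral_eq_zero_of_forall_eq_zero fun u hu => ?_
    refine Set.indicator_of_notMem (s := {u : ℝ | ρ * cos u ≤ d}) (a := u) ?_ _
    exact (key u hu.1.le (by linarith [hu.2])).1 (hu.2.trans_le (min_le_right _ _))
  have e2 : ∫ u in min s (arccos (d / ρ))..s,
      {u : ℝ | ρ * cos u ≤ d}.indicator (fun _ => (1 : ℝ)) u =
        ∫ u in min s (arccos (d / ρ))..s, (1 : ℝ) := by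
    rw [intervalIntegral.integral_of_le hms, intervalIntegral.integral_of_le hms]
    refine setIntegral_congr_fun measurableSet_Ioc fun u hu => ?_
    refine Set.indicator_of_mem (a := u) (s := {u : ℝ | ρ * cos u ≤ d}) ?_ _
    by_contra hcon
    have h1 := (key u (hm0.trans hu.1.le) (hu.2.trans_lt hs)).2 hcon
    exact absurd hu.1 (not_lt.2 (le_min hu.2 h1.le))
  rw [e1, e2]
  simp

theorem integral_indicator_mul_cos_le {ρ d s : ℝ} (hρ : 0 < ρ) (hd : 0 < d)
    (hs : |s| < π / 2) :
    ∫ u in (0 : ℝ)..s, {u : ℝ | ρ * cos u ≤ d}.indicator (fun _ => (1 : ℝ)) u =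
      s - Real.sign s * min |s| (arccos (d / ρ)) := by
  rcases lt_trichotomy s 0 with h | rfl | h
  · rw [abs_of_neg h] at hs ⊢
    have e := integral_indicator_mul_cos_le_of_nonneg hρ hd (by linarith : 0 ≤ -s) hs
    have e' := intervalIntegral.integral_comp_neg (a := 0) (b := -s)
      ({u : ℝ | ρ * cos u ≤ d}.indicator (fun _ => (1 : ℝ)))
    rw [neg_neg, neg_zero] at e'
    rw [intervalIntegral.integral_symm, ← e', Real.sign_of_neg h]
    have e'' : (fun u => {u : ℝ | ρ * cos u ≤ d}.indicator (fun _ => (1 : ℝ)) (-u)) =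
        {u : ℝ | ρ * cos u ≤ d}.indicator (fun _ => (1 : ℝ)) := by
      funext u
      simp [Set.indicator_apply]
    rw [e'', e]
    ring
  · simp
  · rw [abs_of_pos h] at hs ⊢
    rw [integral_indicator_mul_cos_le_of_nonneg hρ hd h.le hs, Real.sign_of_pos h, one_mul]

/-- The point of the plane with polar coordinates `(r, θ)`. -/
noncomputable def polar (r θ : ℝ) : E2 := pt2 (r * cos θ) (r * sin θ)

/-- The determinant of two vectors of the plane. -/
def planeCross (x y : E2) : ℝ := x 0 * y 1 - x 1 * y 0

@[simp] theorem polar_zero (r θ : ℝ) : polar r θ 0 = r * cos θ := by simp [polar, pt2]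

@[simp] theorem polar_one (r θ : ℝ) : polar r θ 1 = r * sin θ := by simp [polar, pt2]

theorem inner_polar_polar (r θ r' θ' : ℝ) :
    inner ℝ (polar r θ) (polar r' θ') = r * r' * cos (θ' - θ) := by
  simp [PiLp.inner_apply, Fin.sum_univ_two, cos_sub]
  ring

theorem exists_mem_planeCross_pos {S : Set E2} (h : (0 : E2) ∈ interior (convexHull ℝ S)) {v : E2}
    (hv : v ≠ 0) : ∃ p ∈ S, 0 < planeCross v p := by
  by_contra! hle
  have hsub : convexHull ℝ S ⊆ {p | planeCross v p ≤ 0} := by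
    refine convexHull_min (fun p hp => hle p hp) (convex_halfSpace_le ⟨?_, ?_⟩ 0)
    · intro p q; simp [planeCross]; ring
    · intro c p; simp [planeCross]; ring
  have hpos : 0 < v 0 ^ 2 + v 1 ^ 2 := by
    by_contra! hcon
    apply hv
    have h0 : v 0 = 0 := by nlinarith [sq_nonneg (v 0), sq_nonneg (v 1)]
    have h1 : v 1 = 0 := by nlinarith [sq_nonneg (v 0), sq_nonneg (v 1)]
    ext i
    fin_cases i
    · simpa using h0
    · simpa using h1
  have hcont : Tendsto (fun t : ℝ => t • pt2 (-v 1) (v 0)) (𝓝[>] 0) (𝓝 0) := by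
    have : Continuous fun t : ℝ => t • pt2 (-v 1) (v 0) := by fun_prop
    simpa using (this.tendsto 0).mono_left nhdsWithin_le_nhds
  obtain ⟨t, ht, ht0⟩ := ((hcont.eventually (mem_interior_iff_mem_nhds.1 h)).and
    (eventually_mem_nhdsWithin (s := Set.Ioi (0 : ℝ)))).exists
  have ht' : planeCross v (t • pt2 (-v 1) (v 0)) ≤ 0 := hsub ht
  have ht0' : 0 < t := ht0
  have hc : planeCross v (t • pt2 (-v 1) (v 0)) = t * (v 0 ^ 2 + v 1 ^ 2) := by
    simp [planeCross, pt2]; ring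
  rw [hc] at ht'
  exact absurd ht' (not_le.2 (mul_pos ht0' hpos))

theorem planeCross_self (x : E2) : planeCross x x = 0 := by unfold planeCross; ring

theorem planeCross_swap (x y : E2) : planeCross y x = -planeCross x y := by unfold planeCross; ring

theorem planeCross_neg_left (x y : E2) : planeCross (-x) y = -planeCross x y := by simp [planeCross]; ring

theorem planeCross_zero_right (x : E2) : planeCross x 0 = 0 := by simp [planeCross]

theorem ne_zero_of_zero_mem_interior {x y z : E2}
    (h : (0 : E2) ∈ interior (convexHull ℝ {x, y, z})) : x ≠ 0 := by
  rintro rfl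
  by_cases hy : y = 0
  · subst hy
    by_cases hz : z = 0
    · subst hz
      obtain ⟨v, hv⟩ := exists_ne (0 : E2)
      obtain ⟨p, hp, hpos⟩ := exists_mem_planeCross_pos h hv
      simp only [Set.mem_insert_iff, Set.mem_singleton_iff, or_self] at hp
      simp [hp, planeCross_zero_right] at hpos
    · obtain ⟨p, hp, hpos⟩ := exists_mem_planeCross_pos h hz
      rcases hp with rfl | rfl | rfl <;> simp [planeCross_zero_right, planeCross_self] at hpos
  · obtain ⟨p, hp, hpos⟩ := exists_mem_planeCross_pos h hy
    obtain ⟨q, hq, hqpos⟩ := exists_mem_planeCross_pos h (neg_ne_zero.2 hy)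
    rw [planeCross_neg_left] at hqpos
    rcases hp with rfl | rfl | rfl <;> rcases hq with rfl | rfl | rfl <;>
      simp [planeCross_zero_right, planeCross_self] at hpos hqpos
    linarith

theorem planeCross_pos_of_planeCross_pos {x y z : E2}
    (h : (0 : E2) ∈ interior (convexHull ℝ {x, y, z})) (hxy : 0 < planeCross x y) :
    0 < planeCross y z := by
  have hy : y ≠ 0 := by
    rintro rfl
    simp [planeCross_zero_right] at hxy
  obtain ⟨p, hp, hpos⟩ := exists_mem_planeCross_pos h hy
  rcases hp with rfl | rfl | rfl
  · rw [planeCross_swap] at hpos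
    linarith
  · simp [planeCross_self] at hpos
  · exact hpos

theorem exists_polar_s19 {x : E2} (hx : x ≠ 0) : ∃ r θ, 0 < r ∧ x = polar r θ := by
  have hz : (⟨x 0, x 1⟩ : ℂ) ≠ 0 := by
    intro h
    apply hx
    ext i
    fin_cases i
    · simpa using congrArg Complex.re h
    · simpa using congrArg Complex.im h
  refine ⟨‖(⟨x 0, x 1⟩ : ℂ)‖, Complex.arg ⟨x 0, x 1⟩, norm_pos_iff.2 hz, ?_⟩
  ext i
  fin_cases i
  · simp [Complex.norm_mul_cos_arg]
  · simp [Complex.norm_mul_sin_arg]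

theorem exists_polar_add {r θ : ℝ} (hr : 0 < r) {y : E2} (h : 0 < planeCross (polar r θ) y) :
    ∃ R w, 0 < R ∧ 0 < w ∧ w < π ∧ y = polar R (θ + w) := by
  set z : ℂ := ⟨y 0 * cos θ + y 1 * sin θ, y 1 * cos θ - y 0 * sin θ⟩ with hz
  have him : 0 < z.im := by
    have : planeCross (polar r θ) y = r * z.im := by simp [planeCross, hz]; ring
    rw [this] at h
    exact pos_of_mul_pos_right h hr.le
  have hz0 : z ≠ 0 := by
    intro h0
    simp [h0] at him
  have hR : 0 < ‖z‖ := norm_pos_iff.2 hz0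
  have hre := Complex.norm_mul_cos_arg z
  have him' := Complex.norm_mul_sin_arg z
  have hsin : 0 < sin z.arg := by
    rw [← him'] at him
    exact pos_of_mul_pos_right him hR.le
  refine ⟨‖z‖, z.arg, hR, ?_, ?_, ?_⟩
  · by_contra! hcon
    exact absurd hsin (not_lt.2 (sin_nonpos_of_nonpos_of_neg_pi_le hcon (Complex.neg_pi_lt_arg z).le))
  · refine lt_of_le_of_ne (Complex.arg_le_pi z) fun hpi => ?_
    rw [hpi, sin_pi] at hsin
    exact lt_irrefl _ hsin
  · have hcs := sin_sq_add_cos_sq θ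
    simp only [hz] at hre him'
    rw [← hz] at hre him'
    ext i
    fin_cases i
    · simp only [Fin.zero_eta, polar_zero, cos_add]
      linear_combination (-cos θ) * hre + sin θ * him' - y 0 * hcs
    · simp only [Fin.mk_one, polar_one, sin_add]
      linear_combination (-sin θ) * hre - cos θ * him' - y 1 * hcs

/-- The foot of the perpendicular from the origin to the line through two points at distances
`r` and `r'`, seen under the angle `w`. -/
theorem exists_foot {r r' w : ℝ} (hr : 0 < r) (hr' : 0 < r') (hw : 0 < w) (hwπ : w < π) :
    ∃ a b d, |a| < π / 2 ∧ |b| < π / 2 ∧ a + b = w ∧ 0 < d ∧ r * cos a = d ∧ r' * cos b = d := by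
  have hsin := sin_pos_of_pos_of_lt_pi hw hwπ
  obtain ⟨a, ha, hfa⟩ : (0 : ℝ) ∈ (fun a => r * cos a - r' * cos (w - a)) ''
      Set.Ioo (w - π / 2) (π / 2) := by
    refine intermediate_value_Ioo' (by linarith) (by fun_prop) ⟨?_, ?_⟩
    · have : 0 < r' * sin w := mul_pos hr' hsin
      simp only [cos_pi_div_two, cos_sub_pi_div_two]
      linarith
    · have : 0 < r * sin w := mul_pos hr hsin
      simp only [sub_sub_cancel, cos_pi_div_two, cos_sub_pi_div_two]
      linarith
  refine ⟨a, w - a, r * cos a, ?_, ?_, by ring, ?_, rfl, ?_⟩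
  · rw [abs_lt]; constructor <;> linarith [ha.1, ha.2]
  · rw [abs_lt]; constructor <;> linarith [ha.1, ha.2]
  · exact mul_pos hr (cos_pos_of_mem_Ioo ⟨by linarith [ha.1], ha.2⟩)
  · simp only at hfa
    linarith

/-- The contribution to the circular transform of the sector spanned by one side. -/
theorem integral_sector {S : Set E2} (h0 : (0 : E2) ∈ convexHull ℝ S)
    {r r' r'' θ w w' w'' a b d ρ : ℝ} (hr : 0 < r) (hr' : 0 < r') (hr'' : 0 < r'')
    (hw : 0 < w) (hwπ : w < π) (hw'π : w' < π) (hw''π : w'' < π)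
    (hsum : w + w' + w'' = 2 * π) (hA : polar r θ ∈ S) (hB : polar r' (θ + w) ∈ S)
    (hS : ∀ p ∈ S, p = polar r θ ∨ p = polar r' (θ + w) ∨ p = polar r'' (θ + w + w'))
    (ha : |a| < π / 2) (hb : |b| < π / 2) (hab : a + b = w) (hd : 0 < d)
    (hra : r * cos a = d) (hrb : r' * cos b = d) (hρ : 0 < ρ) :
    ∫ ψ in θ..θ + w, (convexHull ℝ S).indicator (fun _ => (1 : ℝ)) (polar ρ ψ) =
      w - (Real.sign a * min |a| (arccos (d / ρ)) + Real.sign b * min |b| (arccos (d / ρ))) := by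
  rw [abs_lt] at ha hb
  have hsin := sin_pos_of_pos_of_lt_pi hw hwπ
  have hhalf : convexHull ℝ S ⊆ {p | inner ℝ (polar 1 (θ + a)) p ≤ d} := by
    refine convexHull_min ?_ (convex_halfSpace_le ⟨fun p q => inner_add_right _ _ _,
      fun c p => inner_smul_right _ _ _⟩ d)
    intro p hp
    rw [Set.mem_ofPred_eq]
    rcases hS p hp with rfl | rfl | rfl <;> rw [inner_polar_polar, one_mul]
    · rw [show θ - (θ + a) = -a by ring, cos_neg, hra]
    · rw [show θ + w - (θ + a) = b by linarith, hrb]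
    · rw [show θ + w + w' - (θ + a) = b + w' by linarith]
      have : cos (b + w') ≤ 0 :=
        cos_nonpos_of_pi_div_two_le_of_le (by linarith) (by linarith)
      nlinarith
  have hmem : ∀ t ∈ Set.Icc 0 w, polar ρ (θ + t) ∈ convexHull ℝ S ↔ ρ * cos (t - a) ≤ d := by
    intro t ht
    have hn : inner ℝ (polar 1 (θ + a)) (polar ρ (θ + t)) = ρ * cos (t - a) := by
      rw [inner_polar_polar, one_mul, show θ + t - (θ + a) = t - a by ring]
    constructor
    · intro hp
      have : inner ℝ (polar 1 (θ + a)) (polar ρ (θ + t)) ≤ d := hhalf hp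
      rwa [hn] at this
    · intro hle
      set l := ρ * sin (w - t) / (r * sin w) with hl
      set m := ρ * sin t / (r' * sin w) with hm
      have hl0 : 0 ≤ l := by
        have := sin_nonneg_of_nonneg_of_le_pi (by linarith [ht.2] : 0 ≤ w - t)
          (by linarith [ht.1])
        positivity
      have hm0 : 0 ≤ m := by
        have := sin_nonneg_of_nonneg_of_le_pi ht.1 (by linarith [ht.2])
        positivity
      have hcomb : polar ρ (θ + t) = l • polar r θ + m • polar r' (θ + w) := by
        ext i
        fin_cases i
        · simp [hl, hm, cos_add, sin_sub]
          field_simp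
          ring
        · simp [hl, hm, sin_add, sin_sub]
          field_simp
          ring
      have hlm : (l + m) * d = ρ * cos (t - a) := by
        rw [← hn, hcomb, inner_add_right, inner_smul_right, inner_smul_right, inner_polar_polar,
          inner_polar_polar, show θ - (θ + a) = -a by ring, cos_neg,
          show θ + w - (θ + a) = b by linarith, one_mul, one_mul, hra, hrb]
        ring
      have hlm1 : l + m ≤ 1 := by
        rw [← hlm] at hle
        nlinarith
      rw [hcomb]
      have hcv := (convex_convexHull ℝ S).sum_mem (t := Finset.univ) (w := ![l, m, 1 - l - m])
        (z := ![polar r θ, polar r' (θ + w), 0]) (by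
          intro i _
          fin_cases i
          · exact hl0
          · exact hm0
          · simp; linarith) (by simp [Fin.sum_univ_three]) (by
          intro i _
          fin_cases i
          · exact subset_convexHull ℝ S hA
          · exact subset_convexHull ℝ S hB
          · exact h0)
      simpa [Fin.sum_univ_three] using hcv
  have hi := intervalIntegrable_indicator_one (measurableSet_mul_cos_le ρ d)
  have hshift := intervalIntegral.integral_comp_add_right (a := -a) (b := b)
    (fun ψ => (convexHull ℝ S).indicator (fun _ => (1 : ℝ)) (polar ρ ψ)) (θ + a)
  rw [show -a + (θ + a) = θ by ring, show b + (θ + a) = θ + w by linarith] at hshift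
  rw [← hshift]
  have hcongr : ∫ u in -a..b,
      (convexHull ℝ S).indicator (fun _ => (1 : ℝ)) (polar ρ (u + (θ + a))) =
      ∫ u in -a..b, {u : ℝ | ρ * cos u ≤ d}.indicator (fun _ => (1 : ℝ)) u := by
    refine intervalIntegral.integral_congr fun u hu => ?_
    rw [Set.uIcc_of_le (by linarith)] at hu
    have hiff := hmem (u + a) ⟨by linarith [hu.1], by linarith [hu.2]⟩
    rw [show θ + (u + a) = u + (θ + a) by ring, add_sub_cancel_right] at hiff
    by_cases hu' : ρ * cos u ≤ d
    · exact (Set.indicator_of_mem (hiff.2 hu') _).trans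
        (Set.indicator_of_mem (s := {u : ℝ | ρ * cos u ≤ d}) hu' fun _ => (1 : ℝ)).symm
    · exact (Set.indicator_of_notMem (mt hiff.1 hu') _).trans
        (Set.indicator_of_notMem (s := {u : ℝ | ρ * cos u ≤ d}) hu' _).symm
  rw [hcongr, ← intervalIntegral.integral_add_adjacent_intervals (hi (-a) 0) (hi 0 b),
    intervalIntegral.integral_symm,
    integral_indicator_mul_cos_le hρ hd (by rw [abs_neg]; exact abs_lt.2 ha),
    integral_indicator_mul_cos_le hρ hd (abs_lt.2 hb), abs_neg, Real.sign_neg, ← hab]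
  ring

theorem polar_add_two_pi (r θ : ℝ) : polar r (θ + 2 * π) = polar r θ := by
  simp [polar]

theorem measurableSet_polar_mem {S : Set E2} (hS : S.Finite) (ρ : ℝ) :
    MeasurableSet {ψ : ℝ | polar ρ ψ ∈ convexHull ℝ S} := by
  have hc : Continuous fun ψ : ℝ => polar ρ ψ := by
    unfold polar pt2
    refine (EuclideanSpace.equiv (Fin 2) ℝ).symm.continuous.comp (continuous_pi fun i => ?_)
    fin_cases i <;> simp <;> fun_prop
  exact (hS.isClosed_convexHull ℝ).measurableSet.preimage hc.measurable

theorem circTransform_eq_add_add {S : Set E2} (hS : S.Finite) (ρ θ w w' w'' : ℝ)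
    (hsum : w + w' + w'' = 2 * π) :
    circTransform (convexHull ℝ S) ρ =
      (∫ ψ in θ..θ + w, (convexHull ℝ S).indicator (fun _ => (1 : ℝ)) (polar ρ ψ)) +
      (∫ ψ in θ + w..θ + w + w', (convexHull ℝ S).indicator (fun _ => (1 : ℝ)) (polar ρ ψ)) +
      ∫ ψ in θ + w + w'..θ + w + w' + w'',
        (convexHull ℝ S).indicator (fun _ => (1 : ℝ)) (polar ρ ψ) := by
  have hi : ∀ a b : ℝ, IntervalIntegrable
      (fun ψ => (convexHull ℝ S).indicator (fun _ => (1 : ℝ)) (polar ρ ψ)) volume a b :=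
    intervalIntegrable_indicator_one (measurableSet_polar_mem hS ρ)
  have hper : Function.Periodic
      (fun ψ => (convexHull ℝ S).indicator (fun _ => (1 : ℝ)) (polar ρ ψ)) (2 * π) := fun ψ => by
    simp only [polar_add_two_pi]
  rw [intervalIntegral.integral_add_adjacent_intervals (hi _ _) (hi _ _),
    intervalIntegral.integral_add_adjacent_intervals (hi _ _) (hi _ _),
    show θ + w + w' + w'' = θ + 2 * π by linarith, hper.intervalIntegral_add_eq θ 0, zero_add]
  rfl

/-- A triangle around the origin has polar coordinates adapted to a cyclic ordering of its
vertices. -/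
theorem exists_polar_triangle {x y z : E2} (h : (0 : E2) ∈ interior (convexHull ℝ {x, y, z})) :
    ∃ r r' r'' θ w w' w'' : ℝ, 0 < r ∧ 0 < r' ∧ 0 < r'' ∧ (0 < w ∧ w < π) ∧ (0 < w' ∧ w' < π) ∧
      (0 < w'' ∧ w'' < π) ∧ w + w' + w'' = 2 * π ∧
      ({x, y, z} : Set E2) = {polar r θ, polar r' (θ + w), polar r'' (θ + w + w')} := by
  wlog hxy : 0 < planeCross x y generalizing y z
  · have hx := ne_zero_of_zero_mem_interior h
    obtain ⟨p, hp, hpos⟩ := exists_mem_planeCross_pos h hx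
    have hz : 0 < planeCross x z := by
      rcases hp with rfl | rfl | rfl
      · simp [planeCross_self] at hpos
      · exact absurd hpos hxy
      · exact hpos
    rw [Set.pair_comm] at h ⊢
    exact this h hz
  have hyz := planeCross_pos_of_planeCross_pos h hxy
  have hzx : 0 < planeCross z x := by
    refine planeCross_pos_of_planeCross_pos (x := y) ?_ hyz
    rwa [Set.pair_comm, Set.insert_comm]
  obtain ⟨r, θ, hr, rfl⟩ := exists_polar_s19 (ne_zero_of_zero_mem_interior h)
  obtain ⟨r', w, hr', hw, hwπ, rfl⟩ := exists_polar_add hr hxy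
  obtain ⟨r'', w', hr'', hw', hw'π, rfl⟩ := exists_polar_add hr' hyz
  obtain ⟨t, w'', ht, hw'', hw''π, hx⟩ := exists_polar_add hr'' hzx
  refine ⟨r, r', r'', θ, w, w', w'', hr, hr', hr'', ⟨hw, hwπ⟩, ⟨hw', hw'π⟩, ⟨hw'', hw''π⟩, ?_, rfl⟩
  have hn : ∀ r θ, inner ℝ (polar r θ) (polar r θ) = r ^ 2 := fun r θ => by
    rw [inner_polar_polar, sub_self, cos_zero]
    ring
  have hrt : r = t := by
    have := hn r θ
    rw [hx, hn] at this
    nlinarith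
  have h1 := inner_polar_polar r θ t (θ + w + w' + w'')
  rw [← hx, hn, ← hrt, show θ + w + w' + w'' - θ = w + w' + w'' by ring] at h1
  have hcos : cos (w + w' + w'') = 1 := by
    have : r * r ≠ 0 := (mul_pos hr hr).ne'
    apply mul_left_cancel₀ this
    linarith
  obtain ⟨n, hn⟩ := (cos_eq_one_iff _).1 hcos
  have hn0 : (0 : ℝ) < n := by
    by_contra! hcon
    nlinarith [pi_pos]
  have hn2 : (n : ℝ) < 2 := by
    by_contra! hcon
    nlinarith [pi_pos]
  have : n = 1 := by
    have a : 0 < n := by exact_mod_cast hn0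
    have b : n < 2 := by exact_mod_cast hn2
    omega
  rw [← hn, this]
  simp

theorem exists_profile {x y z : E2} (h : (0 : E2) ∈ interior (convexHull ℝ {x, y, z})) :
    ∃ (V : Fin 3 → E2) (d R : Fin 3 → ℝ) (s : Fin 3 → Fin 3 → ℝ), IsProfile d R s ∧
      Set.range V = {x, y, z} ∧
      (∀ j k, inner ℝ (V j) (V k) =
        if j = k then R j ^ 2 else R j * R k * cos (width s (-j - k))) ∧
      ∀ ρ, 0 < ρ → circTransform (convexHull ℝ {x, y, z}) ρ = 2 * π -
        ∑ p : Slot, Real.sign (s p.1.1 p.1.2) * min |s p.1.1 p.1.2| (arccos (d p.1.1 / ρ)) := by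
  obtain ⟨r, r', r'', θ, w, w', w'', hr, hr', hr'', ⟨hw, hwπ⟩, ⟨hw', hw'π⟩, ⟨hw'', hw''π⟩, hsum,
    hset⟩ := exists_polar_triangle h
  rw [hset] at h ⊢
  obtain ⟨a, b, e, ha, hb, hab, he, hea, heb⟩ := exists_foot hr hr' hw hwπ
  obtain ⟨a', b', e', ha', hb', hab', he', hea', heb'⟩ := exists_foot hr' hr'' hw' hw'π
  obtain ⟨a'', b'', e'', ha'', hb'', hab'', he'', hea'', heb''⟩ := exists_foot hr'' hr hw'' hw''π
  have h0 := interior_subset h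
  have hback : polar r (θ + w + w' + w'') = polar r θ := by
    rw [show θ + w + w' + w'' = θ + 2 * π by linarith, polar_add_two_pi]
  have hcos : cos (w + w') = cos w'' := by
    rw [show w + w' = 2 * π - w'' by linarith, cos_two_pi_sub]
  refine ⟨![polar r θ, polar r' (θ + w), polar r'' (θ + w + w')], ![e', e'', e], ![r, r', r''],
    ![![0, a', b'], ![b'', 0, a''], ![a, b, 0]], ⟨?_, ?_, ?_, ?_⟩, ?_, ?_, ?_⟩
  · intro i
    fin_cases i <;> assumption
  · intro i j hij
    fin_cases i <;> fin_cases j <;> first | exact absurd rfl hij | assumption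
  · intro i j hij
    fin_cases i <;> fin_cases j <;> first | exact absurd rfl hij | assumption
  · rw [sum_slot]
    simp
    linarith
  · rw [Matrix.range_cons, Matrix.range_cons, Matrix.range_cons, Matrix.range_empty,
      Set.union_empty]
    rfl
  · have h01 : inner ℝ (polar r θ) (polar r' (θ + w)) = r * r' * cos w := by
      rw [inner_polar_polar, add_sub_cancel_left]
    have h12 : inner ℝ (polar r' (θ + w)) (polar r'' (θ + w + w')) = r' * r'' * cos w' := by
      rw [inner_polar_polar, add_sub_cancel_left]
    have h02 : inner ℝ (polar r θ) (polar r'' (θ + w + w')) = r * r'' * cos w'' := by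
      rw [inner_polar_polar, show θ + w + w' - θ = w + w' by ring, hcos]
    have hself : ∀ r θ, inner ℝ (polar r θ) (polar r θ) = r ^ 2 := fun r θ => by
      rw [inner_polar_polar, sub_self, cos_zero]
      ring
    have W0 := width_zero ![![0, a', b'], ![b'', 0, a''], ![a, b, 0]]
    have W1 := width_one ![![0, a', b'], ![b'', 0, a''], ![a, b, 0]]
    have W2 := width_two ![![0, a', b'], ![b'', 0, a''], ![a, b, 0]]
    replace W0 : _ = w' := W0.trans hab'
    replace W1 : _ = w'' := W1.trans ((add_comm _ _).trans hab'')
    replace W2 : _ = w := W2.trans hab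
    intro j k
    fin_cases j <;> fin_cases k
    · exact hself _ _
    · exact h01.trans (by rw [← W2]; rfl)
    · exact h02.trans (by rw [← W1]; rfl)
    · exact (real_inner_comm _ _).trans (h01.trans (by rw [← W2, mul_comm r]; rfl))
    · exact hself _ _
    · exact h12.trans (by rw [← W0]; rfl)
    · exact (real_inner_comm _ _).trans (h02.trans (by rw [← W1, mul_comm r]; rfl))
    · exact (real_inner_comm _ _).trans (h12.trans (by rw [← W0, mul_comm r']; rfl))
    · exact hself _ _
  · intro ρ hρ
    rw [circTransform_eq_add_add (by simp) ρ θ w w' w'' hsum, sum_slot fun i j =>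
        Real.sign (![![0, a', b'], ![b'', 0, a''], ![a, b, 0]] i j) *
          min |![![0, a', b'], ![b'', 0, a''], ![a, b, 0]] i j| (arccos (![e', e'', e] i / ρ)),
      integral_sector h0 hr hr' hr'' hw hwπ hw'π hw''π hsum (by simp) (by simp) (by simp)
        ha hb hab he hea heb hρ,
      integral_sector h0 hr' hr'' hr hw' hw'π hw''π hwπ (by linarith) (by simp) (by simp)
        (by rw [hback]; simp) ha' hb' hab' he' hea' heb' hρ,
      integral_sector h0 hr'' hr hr' hw'' hw''π hwπ hw'π (by linarith) (by simp)
        (by rw [hback]; simp) (by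
          rw [hback, show θ + w + w' + w'' + w = θ + w + 2 * π by linarith, polar_add_two_pi]
          simp) ha'' hb'' hab'' he'' hea'' heb'' hρ]
    simp
    linarith

theorem exists_linearIsometryEquiv_of_inner_eq {ι F : Type*} [Fintype ι] [NormedAddCommGroup F]
    [InnerProductSpace ℝ F] [FiniteDimensional ℝ F] (v v' : ι → F)
    (hv : Submodule.span ℝ (Set.range v) = ⊤)
    (h : ∀ i j, inner ℝ (v' i) (v' j) = inner ℝ (v i) (v j)) :
    ∃ O : F ≃ₗᵢ[ℝ] F, ∀ i, O (v i) = v' i := by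
  classical
  have hnorm : ∀ c : ι → ℝ,
      ‖Fintype.linearCombination ℝ v' c‖ = ‖Fintype.linearCombination ℝ v c‖ := by
    intro c
    rw [← sq_eq_sq₀ (norm_nonneg _) (norm_nonneg _), ← real_inner_self_eq_norm_sq,
      ← real_inner_self_eq_norm_sq]
    simp only [Fintype.linearCombination_apply, sum_inner, inner_sum, inner_smul_left,
      inner_smul_right, h]
  obtain ⟨g, hg⟩ := (Fintype.linearCombination ℝ v).exists_rightInverse_of_surjective
    (by rw [Fintype.range_linearCombination, hv])
  have hg' : ∀ x, Fintype.linearCombination ℝ v (g x) = x := fun x => LinearMap.congr_fun hg x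
  let L : F →ₗᵢ[ℝ] F :=
    ⟨(Fintype.linearCombination ℝ v').comp g, fun x => by
      rw [LinearMap.comp_apply, hnorm, hg']⟩
  refine ⟨L.toLinearIsometryEquiv rfl, fun i => ?_⟩
  have hz := hnorm (g (v i) - Pi.single i 1)
  rw [map_sub, map_sub, hg', Fintype.linearCombination_apply_single,
    Fintype.linearCombination_apply_single, one_smul, one_smul, sub_self, norm_zero,
    norm_eq_zero, sub_eq_zero] at hz
  exact hz

theorem span_eq_top_of_interior_convexHull_nonempty {S : Set E2}
    (h : (interior (convexHull ℝ S)).Nonempty) : Submodule.span ℝ S = ⊤ := by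
  have h1 := interior_convexHull_nonempty_iff_affineSpan_eq_top.1 h
  rw [eq_top_iff]
  intro x _
  have hx : x ∈ affineSpan ℝ S := by rw [h1]; trivial
  exact affineSpan_subset_span hx

theorem even_card_filter_slot (d : Fin 3 → ℝ) (D : ℝ) :
    Even (Finset.univ.filter fun p : Slot => d p.1.1 = D).card := by
  rw [Finset.card_filter, sum_slot fun i _ => if d i = D then 1 else 0]
  exact ((Even.add_self _).add (Even.add_self _)).add (Even.add_self _)

theorem IsProfile.sum_slot_eq {d R d' R' : Fin 3 → ℝ} {s s' : Fin 3 → Fin 3 → ℝ}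
    (h : IsProfile d R s) (h' : IsProfile d' R' s')
    (hsum : ∀ ρ, 0 < ρ →
      ∑ p : Slot, Real.sign (s p.1.1 p.1.2) * min |s p.1.1 p.1.2| (arccos (d p.1.1 / ρ)) =
      ∑ p : Slot, Real.sign (s' p.1.1 p.1.2) * min |s' p.1.1 p.1.2| (arccos (d' p.1.1 / ρ)))
    (f : ℝ → ℝ → ℝ) :
    ∑ p : Slot, f (d p.1.1) (s p.1.1 p.1.2) = ∑ p : Slot, f (d' p.1.1) (s' p.1.1 p.1.2) := by
  have hmap := map_eq_of_sum_sign_mul_min_arccos_eq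
    (fun p : Slot => d p.1.1) (fun p => s p.1.1 p.1.2)
    (fun p : Slot => d' p.1.1) (fun p => s' p.1.1 p.1.2)
    (fun p => h.pos _) (fun p => h'.pos _) (fun p => h.abs_lt _ _ p.2)
    (fun p => h'.abs_lt _ _ p.2) h.add_pos h'.add_pos (even_card_filter_slot d)
    (even_card_filter_slot d') hsum
  have := congrArg (fun m : Multiset (ℝ × ℝ) => (m.map fun q => f q.1 q.2).sum) hmap
  simp only [Multiset.map_map] at this
  exact this

theorem neg_sub_perm (σ : Equiv.Perm (Fin 3)) {j k : Fin 3} (hjk : j ≠ k) :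
    -σ j - σ k = σ (-j - k) := by
  revert σ j k
  decide

/-- A triangle enclosing the origin can be recovered from its circular transform up to an
orthogonal transformation: if two triangles containing the origin in their interiors have
the same circular transform, then some orthogonal transformation maps one onto the
other. -/
theorem stmt_19 (x y z x' y' z' : E2)
    (hT : (0 : E2) ∈ interior (convexHull ℝ {x, y, z}))
    (hT' : (0 : E2) ∈ interior (convexHull ℝ {x', y', z'}))
    (hR : ∀ ρ : ℝ, 0 < ρ →
      circTransform (convexHull ℝ {x, y, z}) ρ =
        circTransform (convexHull ℝ {x', y', z'}) ρ) :
    ∃ O : E2 ≃ₗᵢ[ℝ] E2,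
      O '' (convexHull ℝ {x, y, z}) = convexHull ℝ {x', y', z'} := by
  obtain ⟨V, d, R, s, hP, hV, hG, hC⟩ := exists_profile hT
  obtain ⟨V', d', R', s', hP', hV', hG', hC'⟩ := exists_profile hT'
  obtain ⟨σ, hσ⟩ := hP.exists_match hP' <| hP.sum_slot_eq hP' fun ρ hρ => by
    have := hR ρ hρ
    rw [hC ρ hρ, hC' ρ hρ] at this
    linarith
  obtain ⟨O, hO⟩ := exists_linearIsometryEquiv_of_inner_eq V (V' ∘ σ)
    (by rw [hV]; exact span_eq_top_of_interior_convexHull_nonempty ⟨0, hT⟩) (by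
      intro j k
      rw [Function.comp_apply, Function.comp_apply, hG, hG']
      by_cases hjk : j = k
      · rw [if_pos hjk, if_pos (congrArg σ hjk), (hσ j).1]
      · rw [if_neg hjk, if_neg (σ.injective.ne hjk), neg_sub_perm σ hjk, (hσ _).1, (hσ _).1,
          (hσ _).2])
  refine ⟨O, ?_⟩
  have himg := O.toLinearEquiv.toLinearMap.image_convexHull (Set.range V)
  have hcomp : O ∘ V = V' ∘ σ := funext hO
  rw [← hV, ← hV', ← EquivLike.range_comp V' σ, ← hcomp, Set.range_comp]
  exact himg
end
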